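/- There exist universal constants C₁, C₂ > 0 such that the following holds. Let X be a nonempty finite set, let D be a probability distribution on X, and let 𝒜 be a family of subsets of X with finite VC dimension d. Let X^{(m)} = (X_1,…,X_m) be a random vector on X^m whose probability mass function is strictly positive, whose coordinates each have marginal distribution D, and whose log-coefficient satisfies α := α_log(X^{(m)}) < 1/2. Let ε, δ ∈ (0,1). If m ≥ max( C₁ · log(2/δ) / ((1−α) ε²), C₂ · d / ((1−2α) ε²) ), then with probability at least 1 − δ over S = (x_1,…,x_m) ∼ X^{(m)}, for every A ∈ 𝒜 one has | (1/m) Σ_{i=1}^m 1[x_i ∈ A] − D(A) | ≤ ε. -/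

import Mathlib

open Classical
noncomputable section

/-- The configuration obtained from `z` by replacing the `i`-th coordinate with `a`
and the `j`-th coordinate with `b`. -/
def updTwo {Z : Type*} {m : ℕ} (z : Fin m → Z) (i : Fin m) (a : Z) (j : Fin m) (b : Z) :
    Fin m → Z :=
  Function.update (Function.update z i a) j b

/-- The log-influence `I^log_{j,i}` between coordinates `j` and `i` of a random vector on
`𝒵^m` with probability mass function `p`:  `(1/4)` times the supremum, over configurations of
the remaining coordinates and over values `zi zi' zj zj' ∈ 𝒵`, of
`log (p(zi,zj,rest) p(zi',zj',rest) / (p(zi',zj,rest) p(zi,zj',rest)))`. -/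
def logInfluence {Z : Type*} [Fintype Z] {m : ℕ} (p : (Fin m → Z) → ℝ) (i j : Fin m) : ℝ :=
  (1 / 4) * ⨆ w : (Fin m → Z) × Z × Z × Z × Z,
    Real.log (p (updTwo w.1 i w.2.1 j w.2.2.1) * p (updTwo w.1 i w.2.2.2.1 j w.2.2.2.2) /
      (p (updTwo w.1 i w.2.2.2.1 j w.2.2.1) * p (updTwo w.1 i w.2.1 j w.2.2.2.2)))

/-- The log-coefficient `α_log` of a random vector on `𝒵^m` with probability mass function `p`:
the maximum over `i` of `∑_{j ≠ i} I^log_{j,i}`. -/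
def logCoefficient {Z : Type*} [Fintype Z] {m : ℕ} (p : (Fin m → Z) → ℝ) : ℝ :=
  ⨆ i : Fin m, ∑ j ∈ Finset.univ.erase i, logInfluence p i j

/-- A family `A` of subsets of `X` shatters a finite set `F` if every subset of `F` is the
intersection of `F` with some member of `A`. -/
def ShattersFamily {X : Type*} (A : Set (Set X)) (F : Finset X) : Prop :=
  ∀ s ⊆ (F : Set X), ∃ a ∈ A, s = (F : Set X) ∩ a

/-- The VC dimension of a family of subsets of a finite set `X`: the largest cardinality of a
finite subset of `X` shattered by the family. -/
def vcDim {X : Type*} [Fintype X] (A : Set (Set X)) : ℕ :=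
  Finset.univ.sup fun F : Finset X => if ShattersFamily A F then F.card else 0

/-- If the odds ratio of two probabilities `b ≤ a` is at most `exp (4 * r)`, then they differ by
at most `r`. -/
lemma sub_le_of_odds_ratio_le {a b r : ℝ} (hb : 0 ≤ b) (hba : b ≤ a) (ha : a ≤ 1) (hr : 0 ≤ r)
    (h : a * (1 - b) ≤ Real.exp (4 * r) * ((1 - a) * b)) : a - b ≤ r := by
  rcases eq_or_lt_of_le ha with rfl | ha1
  · have : 1 - b ≤ 0 := by simpa using h
    linarith
  rcases eq_or_lt_of_le hb with rfl | hb0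
  · have : a ≤ 0 := by simpa using h
    linarith
  have ha0 : 0 < a := hb0.trans_le hba
  have h1a : 0 < 1 - a := by linarith
  have h1b : 0 < 1 - b := by linarith
  have hlog : Real.log (a / b) + Real.log ((1 - b) / (1 - a)) ≤ 4 * r := by
    rw [← Real.log_mul (by positivity) (by positivity), Real.log_le_iff_le_exp (by positivity),
      div_mul_div_comm, div_le_iff₀ (by positivity)]
    linarith
  have e1 : 2 * (a - b) / (a + b) ≤ Real.log (a / b) := by
    have := Real.le_log_one_add_of_nonneg (x := (a - b) / b) (by
      apply div_nonneg <;> linarith)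
    rw [show (a - b) / b + 2 = (a + b) / b by field_simp; ring,
      show 1 + (a - b) / b = a / b by field_simp; ring] at this
    refine le_of_eq_of_le ?_ this
    field_simp
  have e2 : 2 * (a - b) / (2 - a - b) ≤ Real.log ((1 - b) / (1 - a)) := by
    have := Real.le_log_one_add_of_nonneg (x := (a - b) / (1 - a)) (by
      apply div_nonneg <;> linarith)
    rw [show (a - b) / (1 - a) + 2 = (2 - a - b) / (1 - a) by field_simp; ring,
      show 1 + (a - b) / (1 - a) = (1 - b) / (1 - a) by field_simp; ring] at this
    refine le_of_eq_of_le ?_ this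
    have : 2 - a - b ≠ 0 := by linarith
    field_simp
  have e3 : 4 * (a - b) ≤ 2 * (a - b) / (a + b) + 2 * (a - b) / (2 - a - b) := by
    have h2 : 0 < 2 - a - b := by linarith
    rw [div_add_div _ _ (by positivity) h2.ne', le_div_iff₀ (by positivity)]
    nlinarith [mul_nonneg (sub_nonneg.2 hba) (sq_nonneg (a + b - 1))]
  linarith

/-- Two probability vectors whose cross ratios are at most `exp (4 * r)` are at total variation
distance at most `r`. -/
lemma sum_sub_mul_le_of_cross_ratio_le {Z : Type*} [Fintype Z] {μ ν g : Z → ℝ} {r c : ℝ}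
    (hμ : ∀ z, 0 ≤ μ z) (hν : ∀ z, 0 ≤ ν z) (hμ1 : ∑ z, μ z = 1) (hν1 : ∑ z, ν z = 1)
    (hr : 0 ≤ r) (h : ∀ z z', μ z * ν z' ≤ Real.exp (4 * r) * (μ z' * ν z))
    (hg : ∀ z z', g z - g z' ≤ c) : ∑ z, (μ z - ν z) * g z ≤ r * c := by
  have hne : Nonempty Z := by
    by_contra hZ
    rw [not_nonempty_iff] at hZ
    simp at hμ1
  obtain ⟨z₀, hz₀⟩ := Finite.exists_min g
  have hc : 0 ≤ c := by simpa using hg z₀ z₀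
  set B : Finset Z := Finset.univ.filter fun z => ν z ≤ μ z
  have hμB : ∑ z ∈ B, μ z + ∑ z ∈ Bᶜ, μ z = 1 := by rw [Finset.sum_add_sum_compl, hμ1]
  have hνB : ∑ z ∈ B, ν z + ∑ z ∈ Bᶜ, ν z = 1 := by rw [Finset.sum_add_sum_compl, hν1]
  have htv : ∑ z ∈ B, μ z - ∑ z ∈ B, ν z ≤ r := by
    refine sub_le_of_odds_ratio_le (Finset.sum_nonneg fun z _ => hν z)
      (Finset.sum_le_sum fun z hz => (Finset.mem_filter.1 hz).2) ?_ hr ?_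
    · linarith [Finset.sum_nonneg fun z (_ : z ∈ Bᶜ) => hμ z]
    · rw [show 1 - ∑ z ∈ B, ν z = ∑ z ∈ Bᶜ, ν z by linarith,
        show 1 - ∑ z ∈ B, μ z = ∑ z ∈ Bᶜ, μ z by linarith, mul_comm (∑ z ∈ Bᶜ, μ z),
        Finset.sum_mul_sum, Finset.sum_mul_sum, Finset.mul_sum]
      refine Finset.sum_le_sum fun z _ => ?_
      rw [Finset.mul_sum]
      refine Finset.sum_le_sum fun z' _ => (h z z').trans_eq ?_
      ring
  calc ∑ z, (μ z - ν z) * g z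
      = ∑ z, (μ z - ν z) * (g z - g z₀) := by
        simp only [mul_sub, Finset.sum_sub_distrib, ← Finset.sum_mul, hμ1, hν1]
        ring
    _ ≤ ∑ z, if ν z ≤ μ z then (μ z - ν z) * c else 0 := by
        refine Finset.sum_le_sum fun z _ => ?_
        split_ifs with hz
        · exact mul_le_mul_of_nonneg_left (hg z z₀) (by linarith)
        · exact mul_nonpos_of_nonpos_of_nonneg (by linarith) (by linarith [hz₀ z])
    _ = (∑ z ∈ B, μ z - ∑ z ∈ B, ν z) * c := by
        rw [← Finset.sum_filter, ← Finset.sum_mul, Finset.sum_sub_distrib]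
    _ ≤ r * c := mul_le_mul_of_nonneg_right htv hc

/-- The conditional expectation of `f` at `x` when the `i`-th coordinate is resampled from its
conditional law given the others. -/
def condAvg {Z : Type*} [Fintype Z] {m : ℕ} (p : (Fin m → Z) → ℝ) (i : Fin m)
    (f : (Fin m → Z) → ℝ) (x : Fin m → Z) : ℝ :=
  ∑ z, p (Function.update x i z) / (∑ z', p (Function.update x i z')) * f (Function.update x i z)

/-- One step of the random scan Glauber dynamics. -/
def glauber {Z : Type*} [Fintype Z] {m : ℕ} (p : (Fin m → Z) → ℝ)
    (f : (Fin m → Z) → ℝ) (x : Fin m → Z) : ℝ :=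
  (m : ℝ)⁻¹ * ∑ i, condAvg p i f x

/-- `f` changes by at most `c i` when only the `i`-th coordinate changes. -/
def BoundedDiff {Z : Type*} {m : ℕ} (f : (Fin m → Z) → ℝ) (c : Fin m → ℝ) : Prop :=
  ∀ i x z, |f (Function.update x i z) - f x| ≤ c i

/-- `a` is a symmetric matrix, zero on the diagonal, that bounds the log-influences of `p`. -/
structure InfluenceBound {Z : Type*} {m : ℕ} (p : (Fin m → Z) → ℝ)
    (a : Fin m → Fin m → ℝ) : Prop where
  nonneg : ∀ i j, 0 ≤ a i j
  symm : ∀ i j, a i j = a j i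
  diag : ∀ i, a i i = 0
  cross : ∀ i j, i ≠ j → ∀ x u u' v v',
    p (updTwo x i u j v) * p (updTwo x i u' j v') ≤
      Real.exp (4 * a i j) * (p (updTwo x i u' j v) * p (updTwo x i u j v'))

lemma BoundedDiff.abs_sub_le_sum {Z : Type*} {m : ℕ} {f : (Fin m → Z) → ℝ} {c : Fin m → ℝ}
    (hf : BoundedDiff f c) (x y : Fin m → Z) : |f x - f y| ≤ ∑ i, c i := by
  have h : ∀ s : Finset (Fin m), |f (s.piecewise x y) - f y| ≤ ∑ i ∈ s, c i := by
    intro s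
    induction s using Finset.induction_on with
    | empty => simp
    | insert i s hi ih =>
      rw [Finset.piecewise_insert, Finset.sum_insert hi]
      calc _ = |(f (Function.update (s.piecewise x y) i (x i)) - f (s.piecewise x y)) +
              (f (s.piecewise x y) - f y)| := by ring_nf
        _ ≤ _ := (abs_add_le _ _).trans (add_le_add (hf _ _ _) ih)
  simpa using h Finset.univ

section Concentration

variable {Z : Type*} [Fintype Z] {m : ℕ} {p : (Fin m → Z) → ℝ}

lemma sum_update_pos (hp : ∀ z, 0 < p z) (i : Fin m) (x : Fin m → Z) :
    0 < ∑ z, p (Function.update x i z) :=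
  Finset.sum_pos (fun _ _ => hp _) ⟨x i, Finset.mem_univ _⟩

lemma sum_condProb (hp : ∀ z, 0 < p z) (i : Fin m) (x : Fin m → Z) :
    ∑ z, p (Function.update x i z) / (∑ z', p (Function.update x i z')) = 1 := by
  rw [← Finset.sum_div, div_self (sum_update_pos hp i x).ne']

/-- Reversibility of the resampling of the `i`-th coordinate. -/
lemma sum_resample_swap (i : Fin m) (φ : (Fin m → Z) → (Fin m → Z) → ℝ) :
    ∑ x, ∑ z, p x * (p (Function.update x i z) / (∑ z', p (Function.update x i z'))) *
        φ x (Function.update x i z) =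
      ∑ x, ∑ z, p x * (p (Function.update x i z) / (∑ z', p (Function.update x i z'))) *
        φ (Function.update x i z) x := by
  rw [← Fintype.sum_prod_type', ← Fintype.sum_prod_type']
  have hinv : Function.Involutive
      fun w : (Fin m → Z) × Z => (Function.update w.1 i w.2, w.1 i) := by
    intro w
    simp
  refine Fintype.sum_equiv hinv.toPerm _ _ fun w => ?_
  simp only [Function.Involutive.coe_toPerm, Function.update_idem, Function.update_eq_self]
  ring

lemma sum_mul_sub_condAvg (hp : ∀ z, 0 < p z) (i : Fin m) (g h : (Fin m → Z) → ℝ) :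
    ∑ x, p x * ((g x - condAvg p i g x) * h x) =
      1 / 2 * ∑ x, ∑ z, p x * (p (Function.update x i z) / (∑ z', p (Function.update x i z'))) *
        ((g x - g (Function.update x i z)) * (h x - h (Function.update x i z))) := by
  have h1 : ∑ x, p x * ((g x - condAvg p i g x) * h x) =
      ∑ x, ∑ z, p x * (p (Function.update x i z) / (∑ z', p (Function.update x i z'))) *
        ((g x - g (Function.update x i z)) * h x) := by
    refine Finset.sum_congr rfl fun x _ => ?_
    have : g x = ∑ z, p (Function.update x i z) / (∑ z', p (Function.update x i z')) * g x := by
      rw [← Finset.sum_mul, sum_condProb hp, one_mul]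
    conv_lhs => rw [this]
    rw [condAvg, ← Finset.sum_sub_distrib, Finset.sum_mul, Finset.mul_sum]
    refine Finset.sum_congr rfl fun z _ => ?_
    ring
  have h2 := sum_resample_swap (p := p) i fun x y => (g x - g y) * h x
  have h3 : ∀ u v w : ℝ, u = v → w = u + v → u = 1 / 2 * w := by
    intro u v w h h'
    linarith
  rw [h1]
  refine h3 _ _ _ h2 ?_
  simp only [← Finset.sum_add_distrib]
  refine Finset.sum_congr rfl fun x _ => Finset.sum_congr rfl fun z _ => ?_
  ring

lemma sum_mul_condAvg (hp : ∀ z, 0 < p z) (i : Fin m) (g : (Fin m → Z) → ℝ) :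
    ∑ x, p x * condAvg p i g x = ∑ x, p x * g x := by
  have := sum_mul_sub_condAvg hp i g fun _ => 1
  simp only [mul_one, sub_self, mul_zero, Finset.sum_const_zero, mul_sub,
    Finset.sum_sub_distrib] at this
  linarith

lemma abs_exp_sub_exp_le (a b : ℝ) :
    |Real.exp a - Real.exp b| ≤ |a - b| * ((Real.exp a + Real.exp b) / 2) := by
  wlog hab : b ≤ a generalizing a b
  · rw [abs_sub_comm, abs_sub_comm a, add_comm]
    exact this b a (le_of_not_ge hab)
  have hexp : Real.exp b ≤ Real.exp a := Real.exp_le_exp.2 hab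
  rw [abs_of_nonneg (sub_nonneg.2 hexp), abs_of_nonneg (sub_nonneg.2 hab)]
  have h := Real.le_log_one_add_of_nonneg (x := Real.exp (a - b) - 1)
    (by linarith [Real.one_le_exp (sub_nonneg.2 hab)])
  rw [add_sub_cancel, Real.log_exp, div_le_iff₀ (by linarith [Real.exp_pos (a - b)])] at h
  have hmul : Real.exp (a - b) * Real.exp b = Real.exp a := by
    rw [← Real.exp_add, sub_add_cancel]
  have := mul_le_mul_of_nonneg_right h (Real.exp_pos b).le
  linear_combination 1 / 2 * this - (1 - (a - b) / 2) * hmul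

lemma sum_mul_sub_condAvg_mul_exp_le (hp : ∀ z, 0 < p z) (i : Fin m)
    {f g : (Fin m → Z) → ℝ} {c u : Fin m → ℝ} (hf : BoundedDiff f c) (hg : BoundedDiff g u)
    (hu : 0 ≤ u i) :
    ∑ x, p x * ((g x - condAvg p i g x) * Real.exp (f x)) ≤
      1 / 2 * (u i * c i) * ∑ x, p x * Real.exp (f x) := by
  have hswap := sum_resample_swap (p := p) i fun x _ => Real.exp (f x)
  have hone : ∑ x, ∑ z, p x * (p (Function.update x i z) / (∑ z', p (Function.update x i z'))) *
      Real.exp (f x) = ∑ x, p x * Real.exp (f x) := by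
    refine Finset.sum_congr rfl fun x _ => ?_
    rw [← Finset.sum_mul, ← Finset.mul_sum, sum_condProb hp, mul_one]
  have hsum : ∑ x, p x * Real.exp (f x) =
      ∑ x, ∑ z, p x * (p (Function.update x i z) / (∑ z', p (Function.update x i z'))) *
        ((Real.exp (f x) + Real.exp (f (Function.update x i z))) / 2) := by
    have h3 : ∀ u v w : ℝ, u = v → w = u + v → u = 1 / 2 * w := by
      intro u v w h h'
      linarith
    rw [← hone, h3 _ _ _ hswap rfl, ← Finset.sum_add_distrib, Finset.mul_sum]
    refine Finset.sum_congr rfl fun x _ => ?_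
    rw [← Finset.sum_add_distrib, Finset.mul_sum]
    refine Finset.sum_congr rfl fun z _ => ?_
    ring
  rw [sum_mul_sub_condAvg hp, hsum, mul_assoc]
  refine mul_le_mul_of_nonneg_left ?_ (by norm_num)
  rw [Finset.mul_sum]
  refine Finset.sum_le_sum fun x _ => ?_
  rw [Finset.mul_sum]
  refine Finset.sum_le_sum fun z _ => ?_
  have hk : 0 ≤ p x * (p (Function.update x i z) / (∑ z', p (Function.update x i z'))) :=
    mul_nonneg (hp x).le (div_nonneg (hp _).le (sum_update_pos hp i x).le)
  have h1 : |g x - g (Function.update x i z)| ≤ u i := by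
    rw [abs_sub_comm]; exact hg i x z
  have h2 : |Real.exp (f x) - Real.exp (f (Function.update x i z))| ≤
      c i * ((Real.exp (f x) + Real.exp (f (Function.update x i z))) / 2) := by
    refine (abs_exp_sub_exp_le _ _).trans (mul_le_mul_of_nonneg_right ?_ (by positivity))
    rw [abs_sub_comm]; exact hf i x z
  have h3 := (le_abs_self _).trans
    ((abs_mul _ _).trans_le (mul_le_mul h1 h2 (abs_nonneg _) hu))
  calc _ ≤ _ := mul_le_mul_of_nonneg_left h3 hk
    _ = _ := by ring

lemma condAvg_update_self {f : (Fin m → Z) → ℝ} (i : Fin m) (x : Fin m → Z) (z : Z) :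
    condAvg p i f (Function.update x i z) = condAvg p i f x := by
  simp [condAvg]

lemma BoundedDiff.abs_condAvg_sub_le (hp : ∀ z, 0 < p z) {a : Fin m → Fin m → ℝ}
    (ha : InfluenceBound p a) {f : (Fin m → Z) → ℝ} {c : Fin m → ℝ} (hf : BoundedDiff f c)
    {i j : Fin m} (hij : i ≠ j) (x : Fin m → Z) (y : Z) :
    |condAvg p i f (Function.update x j y) - condAvg p i f x| ≤ c j + a i j * c i := by
  have key : ∀ x y, condAvg p i f (Function.update x j y) - condAvg p i f x ≤
      c j + a i j * c i := by
    intro x y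
    set x' := Function.update x j y with hx'
    set μ : Z → ℝ := fun z => p (Function.update x' i z) / (∑ z', p (Function.update x' i z'))
      with hμ
    set ν : Z → ℝ := fun z => p (Function.update x i z) / (∑ z', p (Function.update x i z'))
      with hν
    have hμ0 : ∀ z, 0 ≤ μ z := fun z => div_nonneg (hp _).le (sum_update_pos hp i x').le
    have hν0 : ∀ z, 0 ≤ ν z := fun z => div_nonneg (hp _).le (sum_update_pos hp i x).le
    have h1 : ∑ z, μ z * (f (Function.update x' i z) - f (Function.update x i z)) ≤ c j := by
      calc _ ≤ ∑ z, μ z * c j := by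
            refine Finset.sum_le_sum fun z _ => mul_le_mul_of_nonneg_left ?_ (hμ0 z)
            rw [hx', Function.update_comm hij.symm]
            exact (le_abs_self _).trans (hf j _ y)
        _ = c j := by rw [← Finset.sum_mul, sum_condProb hp, one_mul]
    have h2 : ∑ z, (μ z - ν z) * f (Function.update x i z) ≤ a i j * c i := by
      refine sum_sub_mul_le_of_cross_ratio_le hμ0 hν0 (sum_condProb hp i x')
        (sum_condProb hp i x) (ha.nonneg i j) (fun z z' => ?_) fun z z' => ?_
      · have := ha.cross i j hij x z z' y (x j)
        have e1 : ∀ z, updTwo x i z j y = Function.update x' i z := fun z => by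
          rw [updTwo, hx', Function.update_comm hij]
        have e2 : ∀ z, updTwo x i z j (x j) = Function.update x i z := fun z => by
          rw [updTwo, Function.update_comm hij, Function.update_eq_self]
        rw [e1, e1, e2, e2] at this
        simp only [hμ, hν]
        rw [div_mul_div_comm, div_mul_div_comm, ← mul_div_assoc]
        exact div_le_div_of_nonneg_right this
          (mul_pos (sum_update_pos hp i x') (sum_update_pos hp i x)).le
      · have := hf i (Function.update x i z') z
        rw [Function.update_idem] at this
        exact (le_abs_self _).trans this
    calc condAvg p i f x' - condAvg p i f x
        = ∑ z, μ z * (f (Function.update x' i z) - f (Function.update x i z)) +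
          ∑ z, (μ z - ν z) * f (Function.update x i z) := by
          rw [condAvg, condAvg, ← Finset.sum_add_distrib, ← Finset.sum_sub_distrib]
          refine Finset.sum_congr rfl fun z _ => ?_
          simp only [hμ, hν]
          ring
      _ ≤ _ := add_le_add h1 h2
  refine abs_sub_le_iff.2 ⟨key x y, ?_⟩
  have := key (Function.update x j y) (x j)
  rwa [Function.update_idem, Function.update_eq_self] at this


/-- The matrix by which the Glauber dynamics contracts vectors of coordinatewise oscillations. -/
def glauberOsc {m : ℕ} (a : Fin m → Fin m → ℝ) (c : Fin m → ℝ) (j : Fin m) : ℝ :=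
  (1 - (m : ℝ)⁻¹) * c j + (m : ℝ)⁻¹ * ∑ i, a i j * c i

lemma BoundedDiff.glauber (hp : ∀ z, 0 < p z) {a : Fin m → Fin m → ℝ}
    (ha : InfluenceBound p a) {f : (Fin m → Z) → ℝ} {c : Fin m → ℝ} (hf : BoundedDiff f c) :
    BoundedDiff (glauber p f) (glauberOsc a c) := by
  intro j x y
  have hm : (0 : ℝ) < m := by exact_mod_cast j.pos
  simp only [_root_.glauber, ← mul_sub, ← Finset.sum_sub_distrib]
  rw [abs_mul, abs_of_pos (inv_pos.2 hm)]
  have h : ∀ i, |condAvg p i f (Function.update x j y) - condAvg p i f x| ≤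
      (if i = j then 0 else c j) + a i j * c i := by
    intro i
    by_cases hij : i = j
    · subst hij
      simp [condAvg_update_self, ha.diag]
    · simpa [hij] using hf.abs_condAvg_sub_le hp ha hij x y
  have h' := (Finset.abs_sum_le_sum_abs (fun i => condAvg p i f (Function.update x j y) -
    condAvg p i f x) Finset.univ).trans (Finset.sum_le_sum fun i _ => h i)
  rw [Finset.sum_add_distrib] at h'
  have h'' : ∑ i, (if i = j then 0 else c j) = m * c j - c j := by
    have : ∀ i, (if i = j then 0 else c j) = c j - if i = j then c j else 0 := by
      intro i; split_ifs <;> simp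
    simp [this]
  rw [h''] at h'
  refine (mul_le_mul_of_nonneg_left h' (inv_pos.2 hm).le).trans_eq ?_
  rw [glauberOsc]
  field_simp

lemma glauberOsc_nonneg {a : Fin m → Fin m → ℝ} (ha : ∀ i j, 0 ≤ a i j) {c : Fin m → ℝ}
    (hc : ∀ i, 0 ≤ c i) (j : Fin m) : 0 ≤ glauberOsc a c j := by
  have hm : (1 : ℝ) ≤ m := by exact_mod_cast j.pos
  have : (m : ℝ)⁻¹ ≤ 1 := inv_le_one_of_one_le₀ hm
  exact add_nonneg (mul_nonneg (by linarith) (hc j)) (mul_nonneg (by positivity)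
    (Finset.sum_nonneg fun i _ => mul_nonneg (ha i j) (hc i)))

/-- Schur's test for the matrix `glauberOsc a`. -/
lemma sum_sq_glauberOsc_le {a : Fin m → Fin m → ℝ} (ha : ∀ i j, 0 ≤ a i j)
    (hsymm : ∀ i j, a i j = a j i) {α : ℝ} (hα : ∀ i, ∑ j, a i j ≤ α) (hm : 0 < m)
    (c : Fin m → ℝ) :
    ∑ j, glauberOsc a c j ^ 2 ≤ (1 - (1 - α) / m) ^ 2 * ∑ j, c j ^ 2 := by
  have hm' : (1 : ℝ) ≤ m := by exact_mod_cast hm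
  have hinv : (m : ℝ)⁻¹ ≤ 1 := inv_le_one_of_one_le₀ hm'
  have hinv0 : (0 : ℝ) ≤ (m : ℝ)⁻¹ := by positivity
  set ρ : ℝ := 1 - (1 - α) / m with hρ
  set b : Fin m → Fin m → ℝ := fun i j => (1 - (m : ℝ)⁻¹) * (if i = j then 1 else 0) +
    (m : ℝ)⁻¹ * a i j with hb
  have hb0 : ∀ i j, 0 ≤ b i j := fun i j => add_nonneg
    (mul_nonneg (by linarith) (by split_ifs <;> norm_num)) (mul_nonneg hinv0 (ha i j))
  have hbs : ∀ i j, b i j = b j i := fun i j => by simp only [hb, hsymm i j, eq_comm]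
  have hrow : ∀ i, ∑ j, b i j ≤ ρ := by
    intro i
    simp only [hb, Finset.sum_add_distrib, ← Finset.mul_sum, Finset.sum_ite_eq,
      Finset.mem_univ, if_true]
    have := mul_le_mul_of_nonneg_left (hα i) hinv0
    rw [hρ, div_eq_inv_mul]
    linarith
  have hρ0 : 0 ≤ ρ := (Finset.sum_nonneg fun j _ => hb0 ⟨0, hm⟩ j).trans (hrow _)
  have hosc : ∀ j, glauberOsc a c j = ∑ i, b j i * c i := by
    intro j
    simp only [glauberOsc, hb, add_mul, Finset.sum_add_distrib, mul_assoc, ← Finset.mul_sum,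
      ite_mul, one_mul, zero_mul, Finset.sum_ite_eq, Finset.mem_univ, if_true, hsymm j]
  calc ∑ j, glauberOsc a c j ^ 2
      ≤ ∑ j, ρ * ∑ i, b j i * c i ^ 2 := by
        refine Finset.sum_le_sum fun j _ => ?_
        rw [hosc]
        refine (Finset.sum_sq_le_sum_mul_sum_of_sq_le_mul Finset.univ (fun i _ => hb0 j i)
          (fun i _ => mul_nonneg (hb0 j i) (sq_nonneg (c i))) fun i _ => le_of_eq ?_).trans
          (mul_le_mul_of_nonneg_right (hrow j) (Finset.sum_nonneg fun i _ =>
            mul_nonneg (hb0 j i) (sq_nonneg (c i))))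
        ring
    _ = ρ * ∑ i, (∑ j, b i j) * c i ^ 2 := by
        rw [← Finset.mul_sum, Finset.sum_comm]
        simp only [Finset.sum_mul, hbs]
    _ ≤ ρ * ∑ i, ρ * c i ^ 2 := by
        gcongr with i
        exact hrow i
    _ = ρ ^ 2 * ∑ j, c j ^ 2 := by
        rw [← Finset.mul_sum]
        ring

lemma sum_mul_glauber (hp : ∀ z, 0 < p z) (hm : 0 < m) (g : (Fin m → Z) → ℝ) :
    ∑ x, p x * glauber p g x = ∑ x, p x * g x := by
  have hm' : (m : ℝ) ≠ 0 := by exact_mod_cast hm.ne'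
  simp only [glauber, Finset.mul_sum, mul_left_comm (p _)]
  rw [Finset.sum_comm]
  simp only [← Finset.mul_sum, sum_mul_condAvg hp]
  simp [hm']

lemma sum_mul_sub_glauber_mul_exp_le (hp : ∀ z, 0 < p z) (hm : 0 < m)
    {f g : (Fin m → Z) → ℝ} {c u : Fin m → ℝ} (hf : BoundedDiff f c) (hg : BoundedDiff g u)
    (hu : ∀ i, 0 ≤ u i) :
    ∑ x, p x * ((g x - glauber p g x) * Real.exp (f x)) ≤
      (m : ℝ)⁻¹ * (1 / 2 * (∑ i, u i * c i) * ∑ x, p x * Real.exp (f x)) := by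
  have hm' : (m : ℝ) ≠ 0 := by exact_mod_cast hm.ne'
  have h1 : ∑ x, p x * ((g x - glauber p g x) * Real.exp (f x)) =
      (m : ℝ)⁻¹ * ∑ i, ∑ x, p x * ((g x - condAvg p i g x) * Real.exp (f x)) := by
    rw [Finset.sum_comm, Finset.mul_sum]
    refine Finset.sum_congr rfl fun x _ => ?_
    rw [← Finset.mul_sum, ← Finset.sum_mul, Finset.sum_sub_distrib, glauber]
    simp only [Finset.sum_const, Finset.card_univ, Fintype.card_fin, nsmul_eq_mul]
    field_simp
  rw [h1, Finset.mul_sum Finset.univ (fun i => u i * c i), Finset.sum_mul]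
  exact mul_le_mul_of_nonneg_left (Finset.sum_le_sum fun i _ =>
    sum_mul_sub_condAvg_mul_exp_le hp i hf hg (hu i)) (by positivity)

/-- The Stein-type inequality behind the concentration theorem. -/
lemma sum_mul_sub_mean_mul_exp_le (hp : ∀ z, 0 < p z) (hp1 : ∑ z, p z = 1) (hm : 0 < m)
    {a : Fin m → Fin m → ℝ} (ha : InfluenceBound p a) {α : ℝ} (hα : ∀ i, ∑ j, a i j ≤ α)
    (hα1 : α < 1) {f g : (Fin m → Z) → ℝ} {c u : Fin m → ℝ} (hf : BoundedDiff f c)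
    (hg : BoundedDiff g u) (hu : ∀ i, 0 ≤ u i) :
    ∑ x, p x * ((g x - ∑ y, p y * g y) * Real.exp (f x)) ≤
      √(∑ i, u i ^ 2) * √(∑ i, c i ^ 2) / (2 * (1 - α)) * ∑ x, p x * Real.exp (f x) := by
  have hm' : (0 : ℝ) < m := by exact_mod_cast hm
  set M := ∑ x, p x * Real.exp (f x) with hM
  have hM0 : 0 ≤ M := Finset.sum_nonneg fun x _ => mul_nonneg (hp x).le (Real.exp_pos _).le
  set ρ : ℝ := 1 - (1 - α) / m with hρ
  have hα0 : 0 ≤ α := (Finset.sum_nonneg fun j _ => ha.nonneg ⟨0, hm⟩ j).trans (hα _)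
  have hρ1 : ρ < 1 := by
    have : 0 < (1 - α) / m := div_pos (by linarith) hm'
    linarith
  have hρ0 : 0 ≤ ρ := by
    have : (1 - α) / m ≤ 1 := by
      rw [div_le_one hm']
      have : (1 : ℝ) ≤ m := by exact_mod_cast hm
      linarith
    linarith
  set G : ℕ → (Fin m → Z) → ℝ := fun k => (glauber p)^[k] g with hG
  set U : ℕ → Fin m → ℝ := fun k => (glauberOsc a)^[k] u with hU
  have hGs : ∀ k, G (k + 1) = glauber p (G k) := fun k => Function.iterate_succ_apply' _ _ _
  have hUs : ∀ k, U (k + 1) = glauberOsc a (U k) := fun k => Function.iterate_succ_apply' _ _ _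
  have hU0 : ∀ k i, 0 ≤ U k i := by
    intro k
    induction k with
    | zero => exact hu
    | succ k ih => rw [hUs]; exact glauberOsc_nonneg ha.nonneg ih
  have hGU : ∀ k, BoundedDiff (G k) (U k) := by
    intro k
    induction k with
    | zero => exact hg
    | succ k ih => rw [hUs, hGs]; exact ih.glauber hp ha
  have hUQ : ∀ k, √(∑ i, U k i ^ 2) ≤ ρ ^ k * √(∑ i, u i ^ 2) := by
    intro k
    induction k with
    | zero => simp [hU]
    | succ k ih =>
      calc √(∑ i, U (k + 1) i ^ 2) ≤ √(ρ ^ 2 * ∑ i, U k i ^ 2) := by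
            rw [hUs]
            exact Real.sqrt_le_sqrt (sum_sq_glauberOsc_le ha.nonneg ha.symm hα hm _)
        _ = ρ * √(∑ i, U k i ^ 2) := by
            rw [Real.sqrt_mul (sq_nonneg _), Real.sqrt_sq hρ0]
        _ ≤ ρ * (ρ ^ k * √(∑ i, u i ^ 2)) := by gcongr
        _ = _ := by ring
  have hmean : ∀ k, ∑ x, p x * G k x = ∑ x, p x * g x := by
    intro k
    induction k with
    | zero => rfl
    | succ k ih => rw [hGs, sum_mul_glauber hp hm, ih]
  set S := √(∑ i, u i ^ 2) * √(∑ i, c i ^ 2) with hS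
  have hS0 : 0 ≤ S := by positivity
  have hstep : ∀ k, ∑ x, p x * ((G k x - G (k + 1) x) * Real.exp (f x)) ≤
      (m : ℝ)⁻¹ * (1 / 2 * (ρ ^ k * S) * M) := by
    intro k
    rw [hGs]
    refine (sum_mul_sub_glauber_mul_exp_le hp hm hf (hGU k) (hU0 k)).trans ?_
    gcongr
    calc ∑ i, U k i * c i ≤ √(∑ i, U k i ^ 2) * √(∑ i, c i ^ 2) :=
          Real.sum_mul_le_sqrt_mul_sqrt _ _ _
      _ ≤ ρ ^ k * √(∑ i, u i ^ 2) * √(∑ i, c i ^ 2) := by gcongr; exact hUQ k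
      _ = _ := by rw [hS]; ring
  have hpartial : ∀ N, ∑ x, p x * ((g x - G N x) * Real.exp (f x)) ≤
      S / (2 * (1 - α)) * M := by
    intro N
    have h1 : ∑ x, p x * ((g x - G N x) * Real.exp (f x)) =
        ∑ k ∈ Finset.range N, ∑ x, p x * ((G k x - G (k + 1) x) * Real.exp (f x)) := by
      rw [Finset.sum_comm]
      refine Finset.sum_congr rfl fun x _ => ?_
      rw [← Finset.mul_sum, ← Finset.sum_mul, Finset.sum_range_sub']
      rfl
    have hgeom : ∑ k ∈ Finset.range N, ρ ^ k ≤ m / (1 - α) := by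
      have := geom_sum_eq hρ1.ne N
      rw [this, ← neg_div_neg_eq, neg_sub, neg_sub]
      have h1α : 0 < 1 - α := by linarith
      have : 1 - ρ = (1 - α) / m := by rw [hρ]; ring
      rw [this, div_div_eq_mul_div]
      gcongr
      nlinarith [pow_nonneg hρ0 N]
    rw [h1]
    refine (Finset.sum_le_sum fun k _ => hstep k).trans ?_
    calc ∑ k ∈ Finset.range N, (m : ℝ)⁻¹ * (1 / 2 * (ρ ^ k * S) * M)
        = (∑ k ∈ Finset.range N, ρ ^ k) * ((m : ℝ)⁻¹ * (1 / 2 * S * M)) := by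
          rw [Finset.sum_mul]
          exact Finset.sum_congr rfl fun k _ => by ring
      _ ≤ m / (1 - α) * ((m : ℝ)⁻¹ * (1 / 2 * S * M)) := by gcongr
      _ = _ := by field_simp
  have hlim : ∀ x, Filter.Tendsto (fun N => G N x) Filter.atTop (nhds (∑ y, p y * g y)) := by
    intro x
    rw [tendsto_iff_dist_tendsto_zero]
    refine squeeze_zero (fun _ => dist_nonneg) (fun N => ?_)
      (g := fun N => ρ ^ N * (√(∑ i, u i ^ 2) * √(∑ _i : Fin m, 1 ^ 2))) ?_
    · rw [← hmean N, Real.dist_eq]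
      have h1 : G N x - ∑ y, p y * G N y = ∑ y, p y * (G N x - G N y) := by
        simp only [mul_sub, Finset.sum_sub_distrib, ← Finset.sum_mul, hp1, one_mul]
      calc |G N x - ∑ y, p y * G N y| ≤ ∑ y, p y * ∑ i, U N i := by
            rw [h1]
            refine (Finset.abs_sum_le_sum_abs _ _).trans (Finset.sum_le_sum fun y _ => ?_)
            rw [abs_mul, abs_of_pos (hp y)]
            exact mul_le_mul_of_nonneg_left ((hGU N).abs_sub_le_sum x y) (hp y).le
        _ = ∑ i, U N i * 1 := by rw [← Finset.sum_mul, hp1, one_mul]; simp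
        _ ≤ √(∑ i, U N i ^ 2) * √(∑ _i : Fin m, 1 ^ 2) := Real.sum_mul_le_sqrt_mul_sqrt _ _ _
        _ ≤ ρ ^ N * √(∑ i, u i ^ 2) * √(∑ _i : Fin m, 1 ^ 2) := by gcongr; exact hUQ N
        _ = _ := by ring
    · have h0 := (tendsto_pow_atTop_nhds_zero_of_lt_one hρ0 hρ1).mul_const
        (√(∑ i, u i ^ 2) * √(∑ _i : Fin m, (1 : ℝ) ^ 2))
      rwa [zero_mul] at h0
  refine le_of_tendsto' (x := Filter.atTop) (tendsto_finsetSum _ fun x _ => ?_) hpartial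
  exact ((tendsto_const_nhds.sub (hlim x)).mul_const _).const_mul _

/-- **Concentration under Dobrushin's condition**: functions with bounded differences have
sub-Gaussian exponential moments. -/
theorem sum_mul_exp_sub_mean_le (hp : ∀ z, 0 < p z) (hp1 : ∑ z, p z = 1) (hm : 0 < m)
    {a : Fin m → Fin m → ℝ} (ha : InfluenceBound p a) {α : ℝ} (hα : ∀ i, ∑ j, a i j ≤ α)
    (hα1 : α < 1) {f : (Fin m → Z) → ℝ} {c : Fin m → ℝ} (hf : BoundedDiff f c) :
    ∑ x, p x * Real.exp (f x - ∑ y, p y * f y) ≤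
      Real.exp ((∑ i, c i ^ 2) / (4 * (1 - α))) := by
  set κ : ℝ := (∑ i, c i ^ 2) / (2 * (1 - α)) with hκ
  set F : (Fin m → Z) → ℝ := fun x => f x - ∑ y, p y * f y with hF
  have hneZ : Nonempty (Fin m → Z) := by
    by_contra h
    rw [not_nonempty_iff] at h
    simp at hp1
  obtain ⟨x₀⟩ := hneZ
  have hc : ∀ i, 0 ≤ c i := fun i => (abs_nonneg _).trans (hf i x₀ (x₀ i))
  set M : ℝ → ℝ := fun t => ∑ x, p x * Real.exp (t * F x) with hM
  have hM' : ∀ t, HasDerivAt M (∑ x, p x * (F x * Real.exp (t * F x))) t := by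
    intro t
    refine HasDerivAt.fun_sum fun x _ => HasDerivAt.const_mul _ ?_
    have := ((hasDerivAt_id t).mul_const (F x)).exp
    simpa [mul_comm] using this
  have hbd : ∀ t, 0 ≤ t → ∑ x, p x * (F x * Real.exp (t * F x)) ≤ t * κ * M t := by
    intro t ht
    have hft : BoundedDiff (fun x => t * F x) fun i => t * c i := by
      intro i x z
      simp only [hF, ← mul_sub, sub_sub_sub_cancel_right]
      rw [abs_mul, abs_of_nonneg ht]
      exact mul_le_mul_of_nonneg_left (hf i x z) ht
    refine (sum_mul_sub_mean_mul_exp_le hp hp1 hm ha hα hα1 hft hf hc).trans_eq ?_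
    have hsq : √(∑ i, c i ^ 2) * √(∑ i, (t * c i) ^ 2) = t * ∑ i, c i ^ 2 := by
      simp only [mul_pow]
      rw [← Finset.mul_sum, Real.sqrt_mul (sq_nonneg t), Real.sqrt_sq ht, mul_left_comm,
        Real.mul_self_sqrt (Finset.sum_nonneg fun i _ => sq_nonneg _)]
    rw [hsq, hκ, hM]
    ring
  set H : ℝ → ℝ := fun t => M t * Real.exp (-(κ * t ^ 2 / 2)) with hH
  have hH' : ∀ t, HasDerivAt H ((∑ x, p x * (F x * Real.exp (t * F x))) *
      Real.exp (-(κ * t ^ 2 / 2)) + M t * (Real.exp (-(κ * t ^ 2 / 2)) * (-(κ * t)))) t := by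
    intro t
    refine (hM' t).mul (HasDerivAt.exp ?_)
    have h := ((hasDerivAt_pow 2 t).const_mul (κ / 2)).neg
    refine (h.congr_deriv ?_).congr_of_eventuallyEq (.of_forall fun t => ?_)
    · push_cast
      ring
    · simp only [Pi.neg_apply]
      ring
  have hanti : AntitoneOn H (Set.Ici 0) := by
    refine antitoneOn_of_deriv_nonpos (convex_Ici 0)
      (fun t _ => (hH' t).continuousAt.continuousWithinAt)
      (fun t _ => (hH' t).differentiableAt.differentiableWithinAt) fun t ht => ?_
    rw [interior_Ici] at ht
    rw [(hH' t).deriv]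
    have := mul_le_mul_of_nonneg_right (hbd t (le_of_lt ht)) (Real.exp_pos (-(κ * t ^ 2 / 2))).le
    linarith
  have h01 := hanti (Set.mem_Ici.2 le_rfl) (Set.mem_Ici.2 zero_le_one) zero_le_one
  simp only [hH, hM, one_mul, zero_mul, Real.exp_zero, mul_one, hp1] at h01
  norm_num at h01
  rw [Real.exp_neg, ← div_eq_mul_inv, div_le_one (Real.exp_pos _)] at h01
  refine h01.trans_eq ?_
  rw [hκ, div_div]
  congr 2
  ring

end Concentration

section Packing

lemma ShattersFamily.card_le_vcDim {X : Type*} [Fintype X] {A : Set (Set X)} {F : Finset X}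
    (hF : ShattersFamily A F) : F.card ≤ vcDim A := by
  have := Finset.le_sup (f := fun F : Finset X => if ShattersFamily A F then F.card else 0)
    (Finset.mem_univ F)
  rwa [if_pos hF] at this

/-- The Sauer–Shelah lemma for the traces on a finite sequence of points. -/
lemma card_le_sum_choose_of_injOn_trace {X : Type*} [Fintype X] {A : Set (Set X)} {n : ℕ}
    (s : Fin n → X) (P : Finset (Set X)) (hPA : ∀ a ∈ P, a ∈ A)
    (hinj : ∀ a ∈ P, ∀ b ∈ P, (∀ j, s j ∈ a ↔ s j ∈ b) → a = b) :
    P.card ≤ ∑ k ∈ Finset.Iic (vcDim A), n.choose k := by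
  set tr : Set X → Finset (Fin n) := fun a => Finset.univ.filter fun j => s j ∈ a with htr
  have hmem : ∀ a j, j ∈ tr a ↔ s j ∈ a := fun a j => by simp [htr]
  set 𝓕 := P.image tr with h𝓕
  have hcard : P.card = 𝓕.card := by
    refine (Finset.card_image_of_injOn fun a ha b hb hab => hinj a ha b hb fun j => ?_).symm
    rw [← hmem, ← hmem, hab]
  have hdim : 𝓕.vcDim ≤ vcDim A := by
    refine Finset.sup_le fun F hF => ?_
    rw [Finset.mem_shatterer] at hF
    have hsh : ∀ t ⊆ F, ∃ a ∈ P, F ∩ tr a = t := by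
      intro t ht
      obtain ⟨u, hu, rfl⟩ := hF ht
      obtain ⟨a, ha, rfl⟩ := Finset.mem_image.1 hu
      exact ⟨a, ha, rfl⟩
    have hinjF : Set.InjOn s F := by
      intro i hi j hj hij
      obtain ⟨a, -, h⟩ := hsh {i} (by simpa using hi)
      have hia : s i ∈ a := by
        rw [← hmem]
        exact (Finset.mem_inter.1 (h ▸ Finset.mem_singleton_self i)).2
      have : j ∈ F ∩ tr a := Finset.mem_inter.2 ⟨hj, (hmem a j).2 (hij ▸ hia)⟩
      rw [h, Finset.mem_singleton] at this
      exact this.symm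
    have hG : ShattersFamily A (F.image s) := by
      intro t ht
      obtain ⟨a, ha, h⟩ := hsh (F.filter fun j => s j ∈ t) (Finset.filter_subset _ _)
      refine ⟨a, hPA a ha, Set.ext fun x => ⟨fun hx => ⟨ht hx, ?_⟩, fun hx => ?_⟩⟩
      · obtain ⟨j, hj, rfl⟩ := Finset.mem_image.1 (Finset.mem_coe.1 (ht hx))
        rw [← hmem]
        exact (Finset.mem_inter.1 (h ▸ Finset.mem_filter.2 ⟨hj, hx⟩)).2
      · obtain ⟨j, hj, rfl⟩ := Finset.mem_image.1 (Finset.mem_coe.1 hx.1)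
        have : j ∈ F ∩ tr a := Finset.mem_inter.2 ⟨hj, (hmem a j).2 hx.2⟩
        rw [h] at this
        exact (Finset.mem_filter.1 this).2
    rw [← Finset.card_image_of_injOn hinjF]
    exact hG.card_le_vcDim
  calc P.card = 𝓕.card := hcard
    _ ≤ 𝓕.shatterer.card := Finset.card_le_card_shatterer _
    _ ≤ ∑ k ∈ Finset.Iic 𝓕.vcDim, (Fintype.card (Fin n)).choose k :=
        Finset.card_shatterer_le_sum_vcDim
    _ ≤ ∑ k ∈ Finset.Iic (vcDim A), n.choose k := by
        rw [Fintype.card_fin]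
        exact Finset.sum_le_sum_of_subset (Finset.Iic_subset_Iic.2 hdim)

lemma sum_choose_le_exp (n d : ℕ) {x : ℝ} (hx : 0 < x) (hx1 : x ≤ 1) :
    ((∑ k ∈ Finset.Iic d, n.choose k : ℕ) : ℝ) ≤ Real.exp (d * Real.log x⁻¹ + n * x) := by
  have h1 : ∑ k ∈ Finset.Iic d, x ^ k * (n.choose k : ℝ) ≤ (x + 1) ^ n := by
    rw [add_pow]
    simp only [one_pow, mul_one]
    calc _ ≤ ∑ k ∈ Finset.range (n + 1) ∪ Finset.Iic d, x ^ k * (n.choose k : ℝ) :=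
          Finset.sum_le_sum_of_subset_of_nonneg Finset.subset_union_right
            fun k _ _ => by positivity
      _ = _ := by
          refine (Finset.sum_subset Finset.subset_union_left fun k _ hk => ?_).symm
          rw [Finset.mem_range, not_lt] at hk
          rw [Nat.choose_eq_zero_of_lt (by omega)]
          simp
  have h2 : (x + 1) ^ n ≤ Real.exp (n * x) := by
    rw [Real.exp_nat_mul]
    exact pow_le_pow_left₀ (by positivity) (Real.add_one_le_exp x) n
  have h3 : x ^ d * ((∑ k ∈ Finset.Iic d, n.choose k : ℕ) : ℝ) ≤ Real.exp (n * x) := by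
    refine le_trans ?_ (h1.trans h2)
    push_cast
    rw [Finset.mul_sum]
    refine Finset.sum_le_sum fun k hk => mul_le_mul_of_nonneg_right ?_ (by positivity)
    exact pow_le_pow_of_le_one hx.le hx1 (Finset.mem_Iic.1 hk)
  rw [Real.exp_add, Real.exp_nat_mul, Real.exp_log (inv_pos.2 hx), inv_pow, ← div_eq_inv_mul,
    le_div_iff₀ (by positivity), mul_comm]
  exact h3

/-- The fraction of the points `w j` on which the sets `a` and `b` differ. -/
def traceDist {X ι : Type*} [Fintype ι] (w : ι → X) (a b : Set X) : ℝ :=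
  ((Finset.univ.filter fun j => ¬(w j ∈ a ↔ w j ∈ b)).card : ℝ) / Fintype.card ι

/-- Separated sets are told apart by few points. -/
lemma exists_separating_tuple {X ι : Type*} [Fintype ι] [Nonempty ι] (w : ι → X)
    (P : Finset (Set X)) (hP : P.Nonempty) {η : ℝ} (hη1 : η ≤ 1)
    (hsep : ∀ a ∈ P, ∀ b ∈ P, a ≠ b → η < traceDist w a b) {n : ℕ}
    (hn : 2 * Real.log P.card ≤ η * n) :
    ∃ t : Fin n → ι, ∀ a ∈ P, ∀ b ∈ P, (∀ j, w (t j) ∈ a ↔ w (t j) ∈ b) → a = b := by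
  by_contra! hcon
  have hN : (0 : ℝ) < Fintype.card ι := by exact_mod_cast Fintype.card_pos
  have hK : (1 : ℝ) ≤ P.card := by exact_mod_cast hP.card_pos
  set ag : Set X × Set X → Finset ι :=
    fun c => Finset.univ.filter fun j => w j ∈ c.1 ↔ w j ∈ c.2 with hag
  have hcover : (Finset.univ : Finset (Fin n → ι)) ⊆
      P.offDiag.biUnion fun c => Fintype.piFinset fun _ => ag c := by
    intro t _
    obtain ⟨a, ha, b, hb, hab, hne⟩ := hcon t
    refine Finset.mem_biUnion.2 ⟨(a, b), Finset.mem_offDiag.2 ⟨ha, hb, hne⟩, ?_⟩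
    simpa [hag] using hab
  have hcard := (Finset.card_le_card hcover).trans Finset.card_biUnion_le
  simp only [Finset.card_univ, Fintype.card_pi, Finset.prod_const, Fintype.card_fin,
    Fintype.card_piFinset] at hcard
  have hag_le : ∀ c ∈ P.offDiag, ((ag c).card : ℝ) ≤ (1 - η) * Fintype.card ι := by
    rintro ⟨a, b⟩ hc
    obtain ⟨ha, hb, hne⟩ := Finset.mem_offDiag.1 hc
    have h := hsep a ha b hb hne
    rw [traceDist, lt_div_iff₀ hN] at h
    have h2 := Finset.card_filter_add_card_filter_not (s := (Finset.univ : Finset ι))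
      (fun j => w j ∈ a ↔ w j ∈ b)
    rw [Finset.card_univ] at h2
    have h3 : ((ag (a, b)).card : ℝ) +
        ((Finset.univ.filter fun j => ¬(w j ∈ a ↔ w j ∈ b)).card : ℝ) = Fintype.card ι := by
      exact_mod_cast h2
    linarith
  have hcard' : (Fintype.card ι : ℝ) ^ n ≤
      (P.card * P.card - P.card) * ((1 - η) * Fintype.card ι) ^ n := by
    calc (Fintype.card ι : ℝ) ^ n ≤ ∑ c ∈ P.offDiag, ((ag c).card : ℝ) ^ n := by
          exact_mod_cast hcard
      _ ≤ ∑ c ∈ P.offDiag, ((1 - η) * Fintype.card ι) ^ n :=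
          Finset.sum_le_sum fun c hc => pow_le_pow_left₀ (by positivity) (hag_le c hc) n
      _ = _ := by
          rw [Finset.sum_const, Finset.offDiag_card, nsmul_eq_mul,
            Nat.cast_sub (Nat.le_mul_self _)]
          push_cast
          ring
  rw [mul_pow, ← mul_assoc] at hcard'
  have h1 : 1 ≤ ((P.card : ℝ) * P.card - P.card) * (1 - η) ^ n :=
    le_of_mul_le_mul_right (by simpa using hcard') (pow_pos hN n)
  have h2 : (1 - η) ^ n ≤ Real.exp (-(η * n)) := by
    rw [show -(η * n) = n * -η by ring, Real.exp_nat_mul]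
    exact pow_le_pow_left₀ (by linarith) (by linarith [Real.add_one_le_exp (-η)]) n
  have h3 : Real.exp (-(η * n)) ≤ ((P.card : ℝ) * P.card)⁻¹ := by
    rw [← Real.exp_log (show (0 : ℝ) < ((P.card : ℝ) * P.card)⁻¹ by positivity), Real.log_inv,
      Real.log_mul (by positivity) (by positivity)]
    exact Real.exp_le_exp.2 (by linarith)
  have h4 : 0 ≤ (P.card : ℝ) * P.card - P.card := by nlinarith
  have h5 := h1.trans (mul_le_mul_of_nonneg_left (h2.trans h3) h4)
  rw [← div_eq_mul_inv, le_div_iff₀ (by positivity)] at h5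
  linarith

/-- **Packing numbers of VC classes** (Dudley). -/
lemma log_card_le_of_separated {X ι : Type*} [Fintype X] [Fintype ι] [Nonempty ι] (w : ι → X)
    {A : Set (Set X)} (P : Finset (Set X)) (hPA : ∀ a ∈ P, a ∈ A) (hP : P.Nonempty) {η : ℝ}
    (hη : 0 < η) (hη1 : η ≤ 1) (hsep : ∀ a ∈ P, ∀ b ∈ P, a ≠ b → η < traceDist w a b) :
    Real.log P.card ≤ 2 * vcDim A * Real.log (4 / η) + 1 / 2 := by
  have hK : (0 : ℝ) < P.card := by exact_mod_cast hP.card_pos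
  set n : ℕ := ⌈2 * Real.log P.card / η⌉₊ with hn
  have hlog : 0 ≤ Real.log P.card := Real.log_natCast_nonneg _
  have hn1 : 2 * Real.log P.card ≤ η * n := by
    have := Nat.le_ceil (2 * Real.log P.card / η)
    rwa [div_le_iff₀ hη, mul_comm _ η] at this
  have hn2 : (n : ℝ) * η ≤ 2 * Real.log P.card + η := by
    have := Nat.ceil_lt_add_one (show 0 ≤ 2 * Real.log P.card / η by positivity)
    have := mul_le_mul_of_nonneg_right this.le hη.le
    rwa [add_mul, one_mul, div_mul_cancel₀ _ hη.ne'] at this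
  obtain ⟨t, ht⟩ := exists_separating_tuple w P hP hη1 hsep hn1
  have h1 := card_le_sum_choose_of_injOn_trace (fun j => w (t j)) P hPA ht
  have h2 : (P.card : ℝ) ≤ _ := (Nat.cast_le.2 h1).trans
    (sum_choose_le_exp n (vcDim A) (x := η / 4) (by positivity) (by linarith))
  rw [← Real.log_le_iff_le_exp hK, inv_div] at h2
  linarith

end Packing

section Chaining

variable {Ω T : Type*} [Fintype Ω] {q : Ω → ℝ}

/-- A maximal inequality for finitely many sub-Gaussian variables. -/
lemma exists_abs_le_and_sum_mul_le (hq : ∀ ω, 0 ≤ q ω) (hq1 : ∑ ω, q ω = 1) (S : Finset T)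
    (hS : S.Nonempty) (Y : T → Ω → ℝ) {v θ L : ℝ} (hθ : 0 < θ)
    (hmgf : ∀ a ∈ S, ∀ t : ℝ, ∑ ω, q ω * Real.exp (t * Y a ω) ≤ Real.exp (v * t ^ 2))
    (hL : Real.log (2 * S.card) ≤ L) :
    ∃ F : Ω → ℝ, (∀ a ∈ S, ∀ ω, |Y a ω| ≤ F ω) ∧ ∑ ω, q ω * F ω ≤ L / θ + v * θ := by
  have hK : (0 : ℝ) < S.card := by exact_mod_cast hS.card_pos
  set W : Ω → ℝ := fun ω => ∑ a ∈ S, (Real.exp (θ * Y a ω) + Real.exp (-θ * Y a ω)) with hW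
  have hW0 : ∀ ω, 0 < W ω := fun ω => Finset.sum_pos (fun a _ => by positivity) hS
  set M := Real.log (2 * S.card) + v * θ ^ 2 with hM
  refine ⟨fun ω => Real.log (W ω) / θ, fun a ha ω => ?_, ?_⟩
  · rw [le_div_iff₀ hθ, Real.le_log_iff_exp_le (hW0 ω)]
    have h1 : Real.exp (θ * Y a ω) + Real.exp (-θ * Y a ω) ≤ W ω :=
      Finset.single_le_sum (f := fun a => Real.exp (θ * Y a ω) + Real.exp (-θ * Y a ω))
        (fun a _ => by positivity) ha
    refine le_trans ?_ h1
    rcases abs_cases (Y a ω) with ⟨h, -⟩ | ⟨h, -⟩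
    · rw [h, mul_comm]
      linarith [Real.exp_pos (-θ * Y a ω)]
    · rw [h, show -Y a ω * θ = -θ * Y a ω by ring]
      linarith [Real.exp_pos (θ * Y a ω)]
  · have hEW : ∑ ω, q ω * W ω ≤ Real.exp M := by
      calc ∑ ω, q ω * W ω = ∑ a ∈ S, (∑ ω, q ω * Real.exp (θ * Y a ω) +
            ∑ ω, q ω * Real.exp (-θ * Y a ω)) := by
            simp only [hW, Finset.mul_sum, mul_add, ← Finset.sum_add_distrib]
            rw [Finset.sum_comm]
        _ ≤ ∑ a ∈ S, (Real.exp (v * θ ^ 2) + Real.exp (v * θ ^ 2)) := by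
            refine Finset.sum_le_sum fun a ha => add_le_add (hmgf a ha θ) ?_
            simpa using hmgf a ha (-θ)
        _ = Real.exp M := by
            rw [hM, Real.exp_add, Real.exp_log (by positivity), Finset.sum_const, nsmul_eq_mul]
            ring
    have hlog : ∀ ω, Real.log (W ω) ≤ M + (W ω * Real.exp (-M) - 1) := by
      intro ω
      have := Real.log_le_sub_one_of_pos (mul_pos (hW0 ω) (Real.exp_pos (-M)))
      rw [Real.log_mul (hW0 ω).ne' (Real.exp_pos _).ne', Real.log_exp] at this
      linarith
    have hE : ∑ ω, q ω * Real.log (W ω) ≤ M := by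
      calc _ ≤ ∑ ω, q ω * (M + (W ω * Real.exp (-M) - 1)) :=
            Finset.sum_le_sum fun ω _ => mul_le_mul_of_nonneg_left (hlog ω) (hq ω)
        _ = (∑ ω, q ω * W ω) * Real.exp (-M) + (∑ ω, q ω) * (M - 1) := by
            rw [Finset.sum_mul, Finset.sum_mul, ← Finset.sum_add_distrib]
            exact Finset.sum_congr rfl fun ω _ => by ring
        _ ≤ Real.exp M * Real.exp (-M) + (∑ ω, q ω) * (M - 1) := by gcongr
        _ = M := by rw [← Real.exp_add, hq1]; simp
    calc ∑ ω, q ω * (Real.log (W ω) / θ) = (∑ ω, q ω * Real.log (W ω)) / θ := by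
          rw [Finset.sum_div]
          exact Finset.sum_congr rfl fun ω _ => by ring
      _ ≤ (L + v * θ ^ 2) / θ := by gcongr; linarith
      _ = L / θ + v * θ := by field_simp

lemma exists_net (𝒜 : Finset T) {ρ : T → T → ℝ} (hself : ∀ a, ρ a a ≤ 0)
    (hsymm : ∀ a b, ρ a b = ρ b a) {η : ℝ} (hη : 0 < η) :
    ∃ P ⊆ 𝒜, (∀ a ∈ P, ∀ b ∈ P, a ≠ b → η < ρ a b) ∧ ∀ a ∈ 𝒜, ∃ b ∈ P, ρ a b ≤ η := by
  obtain ⟨Sep, hSep⟩ : ∃ Sep : Finset T → Prop,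
      ∀ P, Sep P ↔ ∀ a ∈ P, ∀ b ∈ P, a ≠ b → η < ρ a b := ⟨_, fun _ => Iff.rfl⟩
  obtain ⟨P, hP, hmax⟩ := Finset.exists_max_image (𝒜.powerset.filter Sep) Finset.card
    ⟨∅, by simp [hSep]⟩
  rw [Finset.mem_filter, Finset.mem_powerset, hSep] at hP
  refine ⟨P, hP.1, hP.2, fun a ha => ?_⟩
  by_contra! hcon
  have haP : a ∉ P := fun h => absurd (hcon a h) (not_lt.2 ((hself a).trans hη.le))
  have := hmax (insert a P) (by
    rw [Finset.mem_filter, Finset.mem_powerset, hSep]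
    refine ⟨Finset.insert_subset ha hP.1, fun b hb c hc hbc => ?_⟩
    rcases Finset.mem_insert.1 hb with hb | hb <;> rcases Finset.mem_insert.1 hc with hc | hc
    · exact absurd (hb.trans hc.symm) hbc
    · exact hb ▸ hcon c hc
    · rw [hsymm, hc]; exact hcon b hb
    · exact hP.2 b hb c hc hbc)
  rw [Finset.card_insert_of_notMem haP] at this
  omega

/-- **Chaining** for sub-Gaussian processes indexed by a set with polynomial packing numbers. -/
theorem exists_abs_le_of_packing (hq : ∀ ω, 0 ≤ q ω) (hq1 : ∑ ω, q ω = 1) (𝒜 : Finset T)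
    (hne : 𝒜.Nonempty) (Y : T → Ω → ℝ) (ρ : T → T → ℝ) {v B : ℝ} (hv : 0 < v) (hB : 0 < B)
    (hself : ∀ a, ρ a a ≤ 0) (hsymm : ∀ a b, ρ a b = ρ b a)
    (hpack : ∀ P ⊆ 𝒜, P.Nonempty → ∀ k : ℕ,
      (∀ a ∈ P, ∀ b ∈ P, a ≠ b → (1 / 4 : ℝ) ^ k < ρ a b) →
      Real.log (2 * P.card) ≤ B * (k + 1))
    (hmgf : ∀ a ∈ 𝒜, ∀ t : ℝ, ∑ ω, q ω * Real.exp (t * Y a ω) ≤ Real.exp (v * t ^ 2))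
    (hmgf_sub : ∀ a ∈ 𝒜, ∀ b ∈ 𝒜, ∀ t : ℝ,
      ∑ ω, q ω * Real.exp (t * (Y a ω - Y b ω)) ≤ Real.exp (v * ρ a b * t ^ 2))
    (hfin : ∃ K : ℕ, ∀ a ∈ 𝒜, ∀ b ∈ 𝒜, ρ a b ≤ (1 / 4 : ℝ) ^ K → Y a = Y b) :
    ∃ F : Ω → ℝ, (∀ a ∈ 𝒜, ∀ ω, |Y a ω| ≤ F ω) ∧ ∑ ω, q ω * F ω ≤ 10 * √(v * B) := by
  have hnet := fun k : ℕ => exists_net 𝒜 hself hsymm (η := (1 / 4 : ℝ) ^ k) (by positivity)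
  choose P hP hsep hcov using hnet
  have hPne : ∀ k, (P k).Nonempty := fun k => by
    obtain ⟨a, ha⟩ := hne
    obtain ⟨b, hb, -⟩ := hcov k a ha
    exact ⟨b, hb⟩
  obtain ⟨s, hs, rfl⟩ : ∃ s : ℝ, 0 < s ∧ v = s ^ 2 :=
    ⟨√v, Real.sqrt_pos.2 hv, (Real.sq_sqrt hv.le).symm⟩
  obtain ⟨t, ht, rfl⟩ : ∃ t : ℝ, 0 < t ∧ B = t ^ 2 :=
    ⟨√B, Real.sqrt_pos.2 hB, (Real.sq_sqrt hB.le).symm⟩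
  rw [← mul_pow, Real.sqrt_sq (by positivity)]
  have hlevel : ∀ K : ℕ, ∃ F : Ω → ℝ, (∀ a ∈ P K, ∀ ω, |Y a ω| ≤ F ω) ∧
      ∑ ω, q ω * F ω ≤ s * t * (10 - (2 * K + 8) * (1 / 2) ^ K) := by
    intro K
    induction K with
    | zero =>
      obtain ⟨F, hF, hE⟩ := exists_abs_le_and_sum_mul_le hq hq1 (P 0) (hPne 0) Y
        (div_pos ht hs) (fun a ha => hmgf a (hP 0 ha)) (hpack (P 0) (hP 0) (hPne 0) 0 (hsep 0))
      refine ⟨F, hF, hE.trans_eq ?_⟩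
      push_cast
      field_simp
      ring
    | succ K ih =>
      obtain ⟨F, hF, hE⟩ := ih
      choose! π hπ hπρ using hcov K
      have hy : (0 : ℝ) < (1 / 2) ^ K := by positivity
      obtain ⟨F', hF', hE'⟩ := exists_abs_le_and_sum_mul_le hq hq1 (P (K + 1)) (hPne _)
        (fun b ω => Y b ω - Y (π b) ω) (v := s ^ 2 * ((1 / 2) ^ K * (1 / 2) ^ K))
        (θ := t / s * ((1 / 2 : ℝ) ^ K)⁻¹)
        (by positivity)
        (fun a ha r => (hmgf_sub a (hP _ ha) (π a) (hP _ (hπ a (hP _ ha))) r).trans (by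
          have := hπρ a (hP _ ha)
          rw [show (1 / 4 : ℝ) = 1 / 2 * (1 / 2) by norm_num, mul_pow] at this
          gcongr))
        (hpack (P (K + 1)) (hP _) (hPne _) (K + 1) (hsep _))
      refine ⟨fun ω => F ω + F' ω, fun a ha ω => ?_, ?_⟩
      · calc |Y a ω| = |Y (π a) ω + (Y a ω - Y (π a) ω)| := by ring_nf
          _ ≤ _ := (abs_add_le _ _).trans (add_le_add (hF _ (hπ a (hP _ ha)) ω) (hF' a ha ω))
      · simp only [mul_add, Finset.sum_add_distrib]
        refine (add_le_add hE hE').trans_eq ?_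
        rw [pow_succ (1 / 2 : ℝ) K]
        generalize (1 / 2 : ℝ) ^ K = y at hy
        push_cast
        field_simp
        ring
  obtain ⟨K, hK⟩ := hfin
  obtain ⟨F, hF, hE⟩ := hlevel K
  refine ⟨F, fun a ha ω => ?_, hE.trans ?_⟩
  · obtain ⟨b, hb, hab⟩ := hcov K a ha
    rw [hK a ha b (hP K hb) hab]
    exact hF b hb ω
  · have : 0 ≤ s * t * ((2 * K + 8) * (1 / 2) ^ K) := by positivity
    linarith

end Chaining

section LogInfluence

variable {Z : Type*} [Fintype Z] {m : ℕ} {p : (Fin m → Z) → ℝ}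

lemma log_cross_ratio_le_logInfluence (i j : Fin m) (x : Fin m → Z) (u v u' v' : Z) :
    Real.log (p (updTwo x i u j v) * p (updTwo x i u' j v') /
      (p (updTwo x i u' j v) * p (updTwo x i u j v'))) ≤ 4 * logInfluence p i j := by
  rw [logInfluence, ← mul_assoc]
  norm_num only [one_mul]
  exact le_ciSup (f := fun w : (Fin m → Z) × Z × Z × Z × Z =>
    Real.log (p (updTwo w.1 i w.2.1 j w.2.2.1) * p (updTwo w.1 i w.2.2.2.1 j w.2.2.2.2) /
      (p (updTwo w.1 i w.2.2.2.1 j w.2.2.1) * p (updTwo w.1 i w.2.1 j w.2.2.2.2))))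
    (Set.finite_range _).bddAbove (x, u, v, u', v')

lemma logInfluence_nonneg [Nonempty Z] (hp : ∀ z, 0 < p z) (i j : Fin m) :
    0 ≤ logInfluence p i j := by
  obtain ⟨u⟩ := ‹Nonempty Z›
  have := log_cross_ratio_le_logInfluence (p := p) i j (fun _ => u) u u u u
  rw [div_self (mul_pos (hp _) (hp _)).ne', Real.log_one] at this
  linarith

lemma logInfluence_le_swap [Nonempty Z] {i j : Fin m} (hij : i ≠ j) :
    logInfluence p i j ≤ logInfluence p j i := by
  have : (⨆ w : (Fin m → Z) × Z × Z × Z × Z,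
      Real.log (p (updTwo w.1 i w.2.1 j w.2.2.1) * p (updTwo w.1 i w.2.2.2.1 j w.2.2.2.2) /
        (p (updTwo w.1 i w.2.2.2.1 j w.2.2.1) * p (updTwo w.1 i w.2.1 j w.2.2.2.2)))) ≤
      4 * logInfluence p j i := by
    refine ciSup_le fun w => ?_
    have h := log_cross_ratio_le_logInfluence (p := p) j i w.1 w.2.2.1 w.2.1 w.2.2.2.2 w.2.2.2.1
    have hc : ∀ u v, updTwo w.1 j v i u = updTwo w.1 i u j v := fun u v =>
      Function.update_comm hij.symm _ _ _
    rw [hc, hc, hc, hc, mul_comm (p (updTwo w.1 i w.2.1 j w.2.2.2.2))] at h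
    exact h
  rw [logInfluence]
  linarith

/-- The matrix of log-influences, with zero diagonal. -/
def influenceMatrix (p : (Fin m → Z) → ℝ) (i j : Fin m) : ℝ :=
  if i = j then 0 else logInfluence p i j

lemma influenceBound_influenceMatrix [Nonempty Z] (hp : ∀ z, 0 < p z) :
    InfluenceBound p (influenceMatrix p) where
  nonneg i j := by
    rw [influenceMatrix]
    split_ifs
    · exact le_rfl
    · exact logInfluence_nonneg hp i j
  symm i j := by
    rcases eq_or_ne i j with rfl | h
    · rfl
    · rw [influenceMatrix, influenceMatrix, if_neg h, if_neg h.symm]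
      exact le_antisymm (logInfluence_le_swap h) (logInfluence_le_swap h.symm)
  diag i := if_pos rfl
  cross i j hij x u u' v v' := by
    have h := log_cross_ratio_le_logInfluence (p := p) i j x u v u' v'
    have hden := mul_pos (hp (updTwo x i u' j v)) (hp (updTwo x i u j v'))
    rw [Real.log_le_iff_le_exp (div_pos (mul_pos (hp _) (hp _)) hden), div_le_iff₀ hden] at h
    rwa [influenceMatrix, if_neg hij]

lemma sum_influenceMatrix_le (p : (Fin m → Z) → ℝ) (i : Fin m) :
    ∑ j, influenceMatrix p i j ≤ logCoefficient p := by
  have h : ∑ j, influenceMatrix p i j = ∑ j ∈ Finset.univ.erase i, logInfluence p i j := by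
    rw [← Finset.add_sum_erase _ _ (Finset.mem_univ i), influenceMatrix, if_pos rfl, zero_add]
    refine Finset.sum_congr rfl fun j hj => ?_
    rw [influenceMatrix, if_neg (Finset.ne_of_mem_erase hj).symm]
  rw [h]
  exact le_ciSup (f := fun i => ∑ j ∈ Finset.univ.erase i, logInfluence p i j)
    (Set.finite_range _).bddAbove i

end LogInfluence

section Symmetrization

/-- The configuration that follows `s` where `b` is true and `t` elsewhere. -/
def mixConf {X : Type*} {m : ℕ} (b : Fin m → Bool) (s t : Fin m → X) (i : Fin m) : X :=
  if b i then s i else t i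

lemma mixConf_not {X : Type*} {m : ℕ} (b : Fin m → Bool) (s t : Fin m → X) :
    mixConf (fun i => !b i) s t = mixConf b t s := by
  funext i
  cases h : b i <;> simp [mixConf, h]

lemma mixConf_mixConf {X : Type*} {m : ℕ} (b : Fin m → Bool) (s t : Fin m → X) :
    mixConf b (mixConf b s t) (mixConf b t s) = s := by
  funext i
  cases h : b i <;> simp [mixConf, h]

lemma mixConf_updTwo {X : Type*} {m : ℕ} (b : Fin m → Bool) (s t : Fin m → X) (i j : Fin m)
    (u v : Bool) : mixConf (updTwo b i u j v) s t =
      updTwo (mixConf b s t) i (if u then s i else t i) j (if v then s j else t j) := by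
  funext k
  by_cases hj : k = j
  · subst hj
    simp [mixConf, updTwo]
  · by_cases hi : k = i
    · subst hi
      simp [mixConf, updTwo, hj]
    · simp [mixConf, updTwo, hj, hi]

lemma sum_mixConf {X : Type*} [Fintype X] {m : ℕ} (b : Fin m → Bool)
    (φ : (Fin m → X) → (Fin m → X) → ℝ) :
    ∑ s, ∑ t, φ (mixConf b s t) (mixConf b t s) = ∑ s, ∑ t, φ s t := by
  rw [← Fintype.sum_prod_type', ← Fintype.sum_prod_type']
  have hinv : Function.Involutive
      fun w : (Fin m → X) × (Fin m → X) => (mixConf b w.1 w.2, mixConf b w.2 w.1) := by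
    intro w
    simp only [mixConf_mixConf]
  exact Fintype.sum_equiv hinv.toPerm _ _ fun w => rfl

/-- The influences of the law of the random signs given an unordered pair of samples. -/
lemma InfluenceBound.mixConf {X : Type*} {m : ℕ} {p : (Fin m → X) → ℝ} (hp : ∀ z, 0 < p z)
    {a : Fin m → Fin m → ℝ} (ha : InfluenceBound p a) (s t : Fin m → X) {c : ℝ} (hc : 0 < c) :
    InfluenceBound (fun b : Fin m → Bool => p (mixConf b s t) * p (mixConf b t s) / c)
      fun i j => 2 * a i j where
  nonneg i j := mul_nonneg zero_le_two (ha.nonneg i j)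
  symm i j := by rw [ha.symm]
  diag i := by rw [ha.diag, mul_zero]
  cross i j hij x u u' v v' := by
    simp only [mixConf_updTwo]
    have h1 := ha.cross i j hij (_root_.mixConf x s t) (if u then s i else t i)
      (if u' then s i else t i) (if v then s j else t j) (if v' then s j else t j)
    have h2 := ha.cross i j hij (_root_.mixConf x t s) (if u then t i else s i)
      (if u' then t i else s i) (if v then t j else s j) (if v' then t j else s j)
    have h3 := mul_le_mul h1 h2 (mul_pos (hp _) (hp _)).le
      (mul_nonneg (Real.exp_pos _).le (mul_pos (hp _) (hp _)).le)
    have h4 := div_le_div_of_nonneg_right h3 (mul_pos hc hc).le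
    rw [show 4 * (2 * a i j) = 4 * a i j + 4 * a i j by ring, Real.exp_add]
    refine (le_of_eq ?_).trans (h4.trans_eq ?_) <;> ring

/-- The empirical frequency of `a` in the sample `s`. -/
def empMean {X : Type*} {m : ℕ} (s : Fin m → X) (a : Set X) : ℝ :=
  (m : ℝ)⁻¹ * ∑ i, if s i ∈ a then (1 : ℝ) else 0

lemma boundedDiff_sum {Z : Type*} {m : ℕ} {φ : Fin m → Z → ℝ} {e : Fin m → ℝ} {k : ℝ}
    (hk : 0 ≤ k) (h : ∀ i u u', |φ i u - φ i u'| ≤ e i) :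
    BoundedDiff (fun x : Fin m → Z => k * ∑ i, φ i (x i)) fun i => k * e i := by
  intro i x z
  simp only [← mul_sub, ← Finset.sum_sub_distrib]
  rw [abs_mul, abs_of_nonneg hk, Finset.sum_eq_single i]
  · simpa using mul_le_mul_of_nonneg_left (h i z (x i)) hk
  · intro j _ hj
    simp [Function.update_of_ne hj]
  · simp

lemma boundedDiff_empMean {X : Type*} {m : ℕ} (a : Set X) :
    BoundedDiff (fun s : Fin m → X => empMean s a) fun _ => (m : ℝ)⁻¹ := by
  have := boundedDiff_sum (m := m) (Z := X) (φ := fun _ u => if u ∈ a then (1 : ℝ) else 0)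
    (e := fun _ => 1) (k := (m : ℝ)⁻¹) (by positivity)
    (fun i u u' => by split_ifs <;> norm_num)
  simp only [mul_one] at this
  exact this

lemma boundedDiff_sup'_abs_empMean_sub {X : Type*} {m : ℕ} (𝒜 : Finset (Set X))
    (hne : 𝒜.Nonempty) (μ : Set X → ℝ) :
    BoundedDiff (fun s : Fin m → X => 𝒜.sup' hne fun a => |empMean s a - μ a|)
      fun _ => (m : ℝ)⁻¹ := by
  have key : ∀ s t : Fin m → X, (∀ a, |empMean s a - empMean t a| ≤ (m : ℝ)⁻¹) →
      (𝒜.sup' hne fun a => |empMean s a - μ a|) ≤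
        (𝒜.sup' hne fun a => |empMean t a - μ a|) + (m : ℝ)⁻¹ := by
    intro s t h
    refine Finset.sup'_le hne _ fun a ha => ?_
    have h1 := Finset.le_sup' (fun a => |empMean t a - μ a|) ha
    have h2 := abs_sub_le (empMean s a) (empMean t a) (μ a)
    linarith [h a]
  intro i x z
  have h := fun a => boundedDiff_empMean a i x z
  have h' := fun a => (abs_sub_comm _ _).trans_le (h a)
  rw [abs_sub_le_iff]
  constructor
  · linarith [key _ _ h]
  · linarith [key _ _ h']

lemma sum_mul_exp_mul_sub_mean_le {Z : Type*} [Fintype Z] {m : ℕ} {p : (Fin m → Z) → ℝ}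
    (hp : ∀ z, 0 < p z) (hp1 : ∑ z, p z = 1) (hm : 0 < m)
    {a : Fin m → Fin m → ℝ} (ha : InfluenceBound p a) {α : ℝ} (hα : ∀ i, ∑ j, a i j ≤ α)
    (hα1 : α < 1) {f : (Fin m → Z) → ℝ} {c : Fin m → ℝ} (hf : BoundedDiff f c) (θ : ℝ) :
    ∑ x, p x * Real.exp (θ * (f x - ∑ y, p y * f y)) ≤
      Real.exp ((∑ i, c i ^ 2) / (4 * (1 - α)) * θ ^ 2) := by
  have hθ : BoundedDiff (fun x => θ * f x) fun i => |θ| * c i := by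
    intro i x z
    simp only [← mul_sub]
    rw [abs_mul]
    exact mul_le_mul_of_nonneg_left (hf i x z) (abs_nonneg θ)
  have h := sum_mul_exp_sub_mean_le hp hp1 hm ha hα hα1 hθ
  simp only [mul_left_comm _ θ, ← Finset.mul_sum, ← mul_sub, mul_pow, sq_abs] at h
  refine h.trans_eq ?_
  congr 1
  ring

lemma exists_abs_mixConf_sub_le {X : Type*} [Fintype X] {m : ℕ} (hm : 0 < m)
    {q : (Fin m → Bool) → ℝ} (hq : ∀ b, 0 < q b) (hq1 : ∑ b, q b = 1)
    (hqs : ∀ b, q (fun i => !b i) = q b) {c : Fin m → Fin m → ℝ} (hc : InfluenceBound q c)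
    {β : ℝ} (hβ : ∀ i, ∑ j, c i j ≤ β) (hβ1 : β < 1) {A : Set (Set X)} (𝒜 : Finset (Set X))
    (h𝒜 : ∀ a ∈ 𝒜, a ∈ A) (hne : 𝒜.Nonempty) (hd : 1 ≤ vcDim A) (s t : Fin m → X) :
    ∃ F : (Fin m → Bool) → ℝ,
      (∀ a ∈ 𝒜, ∀ b, |empMean (mixConf b s t) a - empMean (mixConf b t s) a| ≤ F b) ∧
      ∑ b, q b * F b ≤ 10 * √(4 / (m * (1 - β)) * (5 * vcDim A)) := by
  have hm' : (0 : ℝ) < m := by exact_mod_cast hm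
  have h1β : 0 < 1 - β := by linarith
  have hd' : (1 : ℝ) ≤ vcDim A := by exact_mod_cast hd
  have : Nonempty (Fin m ⊕ Fin m) := ⟨Sum.inl ⟨0, hm⟩⟩
  set w : Fin m ⊕ Fin m → X := Sum.elim s t with hw
  have hcardw : (Fintype.card (Fin m ⊕ Fin m) : ℝ) = 2 * m := by
    simp [two_mul]
  set ψ : Set X → Fin m → Bool → ℝ := fun a i u =>
    (if (if u then s i else t i) ∈ a then (1 : ℝ) else 0) -
      (if (if u then t i else s i) ∈ a then (1 : ℝ) else 0) with hψ
  set Y : Set X → (Fin m → Bool) → ℝ := fun a b =>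
    empMean (mixConf b s t) a - empMean (mixConf b t s) a with hY
  have hYψ : ∀ a b, Y a b = (m : ℝ)⁻¹ * ∑ i, ψ a i (b i) := by
    intro a b
    simp only [hY, hψ, empMean, mixConf, ← mul_sub, Finset.sum_sub_distrib]
    rfl
  have hmean : ∀ a, ∑ b, q b * Y a b = 0 := by
    intro a
    have hinv : Function.Involutive fun (b : Fin m → Bool) i => !b i := by
      intro b
      simp
    have h := Equiv.sum_comp hinv.toPerm fun b => q b * Y a b
    simp only [Function.Involutive.coe_toPerm, hqs, hY, mixConf_not] at h
    have h2 : ∑ b, q b * (empMean (mixConf b t s) a - empMean (mixConf b s t) a) =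
        -∑ b, q b * Y a b := by
      rw [← Finset.sum_neg_distrib]
      exact Finset.sum_congr rfl fun b _ => by simp only [hY]; ring
    rw [h2] at h
    change -∑ b, q b * Y a b = ∑ b, q b * Y a b at h
    linarith
  have hmgf : ∀ a ∈ 𝒜, ∀ r : ℝ, ∑ b, q b * Real.exp (r * Y a b) ≤
      Real.exp (4 / (m * (1 - β)) * r ^ 2) := by
    intro a _ r
    have hbd : BoundedDiff (Y a) fun _ => (m : ℝ)⁻¹ * 2 := by
      have := boundedDiff_sum (φ := ψ a) (e := fun _ => 2) (k := (m : ℝ)⁻¹) (by positivity)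
        (fun i u u' => by simp only [hψ]; split_ifs <;> norm_num)
      simpa only [← hYψ] using this
    have h := sum_mul_exp_mul_sub_mean_le hq hq1 hm hc hβ hβ1 hbd r
    simp only [hmean, sub_zero] at h
    refine h.trans (Real.exp_le_exp.2 (mul_le_mul_of_nonneg_right ?_ (sq_nonneg r)))
    rw [Finset.sum_const, Finset.card_univ, Fintype.card_fin, nsmul_eq_mul]
    have : (m : ℝ) * ((m : ℝ)⁻¹ * 2) ^ 2 / (4 * (1 - β)) = 1 / (m * (1 - β)) := by
      field_simp
      norm_num
    rw [this]
    gcongr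
    norm_num
  have hmgf_sub : ∀ a ∈ 𝒜, ∀ a' ∈ 𝒜, ∀ r : ℝ,
      ∑ b, q b * Real.exp (r * (Y a b - Y a' b)) ≤
        Real.exp (4 / (m * (1 - β)) * traceDist w a a' * r ^ 2) := by
    intro a _ a' _ r
    set e : (Fin m → X) → Fin m → ℝ := fun s i => if ¬(s i ∈ a ↔ s i ∈ a') then 1 else 0 with he
    have hbd : BoundedDiff (fun b => Y a b - Y a' b) fun i => (m : ℝ)⁻¹ * (2 * (e s i + e t i)) := by
      have := boundedDiff_sum (φ := fun i u => ψ a i u - ψ a' i u)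
        (e := fun i => 2 * (e s i + e t i)) (k := (m : ℝ)⁻¹) (by positivity)
        (fun i u u' => by
          simp only [hψ, he]
          by_cases h1 : s i ∈ a <;> by_cases h2 : s i ∈ a' <;> by_cases h3 : t i ∈ a <;>
            by_cases h4 : t i ∈ a' <;> cases u <;> cases u' <;> simp [h1, h2, h3, h4] <;>
            norm_num)
      simpa only [hYψ, ← mul_sub, ← Finset.sum_sub_distrib] using this
    have h := sum_mul_exp_mul_sub_mean_le hq hq1 hm hc hβ hβ1 hbd r
    have h0 : ∑ b, q b * (Y a b - Y a' b) = 0 := by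
      simp only [mul_sub, Finset.sum_sub_distrib, hmean, sub_zero]
    simp only [h0, sub_zero] at h
    refine h.trans (Real.exp_le_exp.2 (mul_le_mul_of_nonneg_right ?_ (sq_nonneg r)))
    have hsq : ∀ i, ((m : ℝ)⁻¹ * (2 * (e s i + e t i))) ^ 2 ≤
        (m : ℝ)⁻¹ ^ 2 * (8 * (e s i + e t i)) := by
      intro i
      rw [mul_pow]
      refine mul_le_mul_of_nonneg_left ?_ (by positivity)
      simp only [he]
      split_ifs <;> norm_num
    have hcount : ∑ i, (e s i + e t i) = traceDist w a a' * (2 * m) := by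
      rw [traceDist, hcardw, div_mul_cancel₀ _ (by positivity), Finset.sum_add_distrib,
        Finset.card_filter]
      push_cast
      rw [Fintype.sum_sum_type]
      simp only [hw, he, Sum.elim_inl, Sum.elim_inr]
    calc (∑ i, ((m : ℝ)⁻¹ * (2 * (e s i + e t i))) ^ 2) / (4 * (1 - β))
        ≤ (∑ i, (m : ℝ)⁻¹ ^ 2 * (8 * (e s i + e t i))) / (4 * (1 - β)) := by
          gcongr with i
          exact hsq i
      _ = 4 / (m * (1 - β)) * traceDist w a a' := by
          rw [← Finset.mul_sum, ← Finset.mul_sum, hcount]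
          field_simp
          ring
  refine exists_abs_le_of_packing (fun b => (hq b).le) hq1 𝒜 hne Y (traceDist w)
    (by positivity) (by positivity) (fun a => ?_) (fun a a' => ?_) (fun P hP hPne k hsep => ?_)
    hmgf hmgf_sub ⟨m + 1, fun a ha a' ha' h => ?_⟩
  · simp [traceDist]
  · simp only [traceDist, iff_comm]
  · have h := log_card_le_of_separated w P (fun a ha => h𝒜 a (hP ha)) hPne
      (η := (1 / 4 : ℝ) ^ k) (by positivity) (pow_le_one₀ (by norm_num) (by norm_num)) hsep
    have hP0 : (P.card : ℝ) ≠ 0 := by exact_mod_cast hPne.card_pos.ne'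
    have hlog4 : Real.log (4 / (1 / 4 : ℝ) ^ k) = (k + 1) * (2 * Real.log 2) := by
      rw [show (4 : ℝ) / (1 / 4) ^ k = (2 ^ 2) ^ (k + 1) by
        rw [one_div, inv_pow, div_inv_eq_mul, pow_succ]; norm_num; ring, Real.log_pow,
        Real.log_pow]
      push_cast
      ring
    rw [hlog4] at h
    rw [Real.log_mul two_ne_zero hP0]
    have h2 := Real.log_two_lt_d9
    have hk : (1 : ℝ) ≤ k + 1 := by linarith [k.cast_nonneg (α := ℝ)]
    have hdk : (1 : ℝ) ≤ vcDim A * (k + 1) := one_le_mul_of_one_le_of_one_le hd' hk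
    nlinarith [mul_le_mul_of_nonneg_left h2.le (zero_le_one.trans hdk)]
  · have hempty : traceDist w a a' = 0 := by
      by_contra h0
      have hpos : 0 < (Finset.univ.filter fun j => ¬(w j ∈ a ↔ w j ∈ a')).card := by
        refine Nat.pos_of_ne_zero fun hz => h0 ?_
        rw [traceDist, hz]
        simp
      have h1 : (1 : ℝ) ≤ (Finset.univ.filter fun j => ¬(w j ∈ a ↔ w j ∈ a')).card := by
        exact_mod_cast hpos
      rw [traceDist, hcardw, div_le_iff₀ (by positivity), one_div, inv_pow, inv_mul_eq_div,
        le_div_iff₀ (by positivity)] at h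
      have h3 : (2 * m : ℝ) < 4 ^ (m + 1) := by
        have h4 : m < 2 ^ m := Nat.lt_two_pow_self
        have h5 : 2 ^ m ≤ 4 ^ m := Nat.pow_le_pow_left (by norm_num) m
        have h6 : 2 * m < 4 ^ (m + 1) := by rw [pow_succ]; omega
        exact_mod_cast h6
      have h7 : (0 : ℝ) < 4 ^ (m + 1) := by positivity
      nlinarith
    rw [traceDist, div_eq_zero_iff] at hempty
    have hz : (Finset.univ.filter fun j => ¬(w j ∈ a ↔ w j ∈ a')) = ∅ := by
      rcases hempty with h | h
      · exact Finset.card_eq_zero.1 (by exact_mod_cast h)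
      · rw [hcardw] at h
        linarith
    rw [Finset.filter_eq_empty_iff] at hz
    have hall : ∀ j, w j ∈ a ↔ w j ∈ a' := fun j => not_not.1 (hz (Finset.mem_univ j))
    have hs : ∀ i, s i ∈ a ↔ s i ∈ a' := fun i => hall (Sum.inl i)
    have ht : ∀ i, t i ∈ a ↔ t i ∈ a' := fun i => hall (Sum.inr i)
    funext b
    rw [hYψ, hYψ]
    congr 1
    refine Finset.sum_congr rfl fun i _ => ?_
    simp only [hψ]
    cases b i <;> simp [hs, ht]

end Symmetrization

section UniformConvergence

variable {X : Type*} [Fintype X] {m : ℕ} {p : (Fin m → X) → ℝ}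

/-- Randomly exchanging the coordinates of two independent samples bounds the expected
largest difference of their empirical frequencies. -/
lemma exists_abs_empMean_sub_le (hp : ∀ z, 0 < p z) (hp1 : ∑ z, p z = 1) (hm : 0 < m)
    {c : Fin m → Fin m → ℝ} (hc : InfluenceBound p c) {α : ℝ} (hα : ∀ i, ∑ j, c i j ≤ α)
    (hα1 : α < 1 / 2) {A : Set (Set X)} (𝒜 : Finset (Set X)) (h𝒜 : ∀ a ∈ 𝒜, a ∈ A)
    (hne : 𝒜.Nonempty) (hd : 1 ≤ vcDim A) :
    ∃ G : (Fin m → X) → (Fin m → X) → ℝ,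
      (∀ a ∈ 𝒜, ∀ s t, |empMean s a - empMean t a| ≤ G s t) ∧
      ∑ s, ∑ t, p s * p t * G s t ≤ 10 * √(4 / (m * (1 - 2 * α)) * (5 * vcDim A)) := by
  set M := 10 * √(4 / (m * (1 - 2 * α)) * (5 * vcDim A)) with hM
  set G : (Fin m → X) → (Fin m → X) → ℝ := fun s t =>
    𝒜.sup' hne fun a => |empMean s a - empMean t a| with hG
  refine ⟨G, fun a ha s t => Finset.le_sup' (fun a => |empMean s a - empMean t a|) ha, ?_⟩
  have hmix : ∀ s t, ∑ b, p (mixConf b s t) * p (mixConf b t s) *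
      G (mixConf b s t) (mixConf b t s) ≤ (∑ b, p (mixConf b s t) * p (mixConf b t s)) * M := by
    intro s t
    set C := ∑ b, p (mixConf b s t) * p (mixConf b t s) with hC
    have hC0 : 0 < C := Finset.sum_pos (fun b _ => mul_pos (hp _) (hp _)) Finset.univ_nonempty
    obtain ⟨F, hF, hE⟩ := exists_abs_mixConf_sub_le hm
      (q := fun b => p (mixConf b s t) * p (mixConf b t s) / C)
      (fun b => div_pos (mul_pos (hp _) (hp _)) hC0)
      (by rw [← Finset.sum_div, ← hC, div_self hC0.ne'])
      (fun b => by simp only [mixConf_not]; ring)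
      (hc.mixConf hp s t hC0) (β := 2 * α)
      (fun i => by rw [← Finset.mul_sum]; linarith [hα i]) (by linarith) 𝒜 h𝒜 hne hd s t
    have hGF : ∀ b, G (mixConf b s t) (mixConf b t s) ≤ F b := fun b =>
      Finset.sup'_le hne _ fun a ha => hF a ha b
    calc ∑ b, p (mixConf b s t) * p (mixConf b t s) * G (mixConf b s t) (mixConf b t s)
        ≤ ∑ b, p (mixConf b s t) * p (mixConf b t s) * F b :=
          Finset.sum_le_sum fun b _ =>
            mul_le_mul_of_nonneg_left (hGF b) (mul_pos (hp _) (hp _)).le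
      _ = C * ∑ b, p (mixConf b s t) * p (mixConf b t s) / C * F b := by
          rw [Finset.mul_sum]
          refine Finset.sum_congr rfl fun b _ => ?_
          field_simp
      _ ≤ C * M := mul_le_mul_of_nonneg_left hE hC0.le
  have hswap : ∀ φ : (Fin m → X) → (Fin m → X) → ℝ,
      ∑ s, ∑ t, ∑ b, φ (mixConf b s t) (mixConf b t s) =
        (Fintype.card (Fin m → Bool) : ℝ) * ∑ s, ∑ t, φ s t := by
    intro φ
    calc ∑ s, ∑ t, ∑ b, φ (mixConf b s t) (mixConf b t s)
        = ∑ b, ∑ s, ∑ t, φ (mixConf b s t) (mixConf b t s) := by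
          simp only [Finset.sum_comm (s := (Finset.univ : Finset (Fin m → X)))
            (t := (Finset.univ : Finset (Fin m → Bool)))]
      _ = _ := by
          simp only [sum_mixConf, Finset.sum_const, Finset.card_univ, nsmul_eq_mul]
  have htotal : ∑ s, ∑ t, ∑ b, p (mixConf b s t) * p (mixConf b t s) *
      G (mixConf b s t) (mixConf b t s) ≤
      (∑ s, ∑ t, ∑ b, p (mixConf b s t) * p (mixConf b t s)) * M := by
    simp only [Finset.sum_mul]
    simp only [Finset.sum_mul] at hmix
    exact Finset.sum_le_sum fun s _ => Finset.sum_le_sum fun t _ => hmix s t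
  rw [hswap fun s t => p s * p t * G s t, hswap fun s t => p s * p t, mul_assoc] at htotal
  simp only [← Finset.mul_sum, hp1, mul_one, one_mul] at htotal
  simp only [mul_assoc, ← Finset.mul_sum] at htotal ⊢
  exact le_of_mul_le_mul_left htotal (by exact_mod_cast Fintype.card_pos)

lemma card_le_one_of_vcDim_eq_zero {A : Set (Set X)} (hA : vcDim A = 0) (𝒜 : Finset (Set X))
    (h𝒜 : ∀ a ∈ 𝒜, a ∈ A) : 𝒜.card ≤ 1 := by
  have h := card_le_sum_choose_of_injOn_trace (Fintype.equivFin X).symm 𝒜 h𝒜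
    fun a _ b _ hab => Set.ext fun x => by simpa using hab (Fintype.equivFin X x)
  rwa [hA, show Finset.Iic 0 = {0} from rfl, Finset.sum_singleton, Nat.choose_zero_right] at h

/-- The expected uniform deviation of a family of sets. -/
lemma sum_mul_sup'_le (hp : ∀ z, 0 < p z) (hp1 : ∑ z, p z = 1) (hm : 0 < m)
    {c : Fin m → Fin m → ℝ} (hc : InfluenceBound p c) {α : ℝ} (hα : ∀ i, ∑ j, c i j ≤ α)
    (hα1 : α < 1 / 2) {A : Set (Set X)} (𝒜 : Finset (Set X)) (h𝒜 : ∀ a ∈ 𝒜, a ∈ A)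
    (hne : 𝒜.Nonempty) {μ : Set X → ℝ} (hμ : ∀ a, ∑ s, p s * empMean s a = μ a) :
    ∑ s, p s * (𝒜.sup' hne fun a => |empMean s a - μ a|) ≤
      max (√(m * (1 - α)))⁻¹ (10 * √(4 / (m * (1 - 2 * α)) * (5 * vcDim A))) := by
  have hm' : (0 : ℝ) < m := by exact_mod_cast hm
  have h1α : 0 < 1 - α := by linarith
  rcases Nat.eq_zero_or_pos (vcDim A) with hd | hd
  · refine le_max_of_le_left ?_
    have hpos : 0 < √(m * (1 - α)) := Real.sqrt_pos.2 (mul_pos hm' h1α)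
    have hmgf : ∀ a ∈ 𝒜, ∀ t : ℝ, ∑ s, p s * Real.exp (t * (empMean s a - μ a)) ≤
        Real.exp (1 / (4 * (m * (1 - α))) * t ^ 2) := by
      intro a _ t
      have h := sum_mul_exp_mul_sub_mean_le hp hp1 hm hc hα (by linarith)
        (boundedDiff_empMean a) t
      simp only [hμ, Finset.sum_const, Finset.card_univ, Fintype.card_fin, nsmul_eq_mul] at h
      refine h.trans_eq ?_
      congr 2
      field_simp
    have hcard : (𝒜.card : ℝ) = 1 := by
      exact_mod_cast le_antisymm (card_le_one_of_vcDim_eq_zero hd 𝒜 h𝒜) hne.card_pos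
    obtain ⟨F, hF, hE⟩ := exists_abs_le_and_sum_mul_le (fun s => (hp s).le) hp1 𝒜 hne
      (fun a s => empMean s a - μ a) hpos hmgf (L := Real.log 2) (by rw [hcard, mul_one])
    calc ∑ s, p s * (𝒜.sup' hne fun a => |empMean s a - μ a|)
        ≤ ∑ s, p s * F s := Finset.sum_le_sum fun s _ =>
          mul_le_mul_of_nonneg_left (Finset.sup'_le hne _ fun a ha => hF a ha s) (hp s).le
      _ ≤ _ := hE
      _ = (Real.log 2 + 1 / 4) * (√(m * (1 - α)))⁻¹ := by
          have hsq := Real.sq_sqrt (mul_pos hm' h1α).le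
          rw [← hsq, Real.sqrt_sq hpos.le]
          field_simp
      _ ≤ 1 * (√(m * (1 - α)))⁻¹ := by
          refine mul_le_mul_of_nonneg_right ?_ (inv_pos.2 hpos).le
          linarith [Real.log_two_lt_d9]
      _ = _ := one_mul _
  · refine le_max_of_le_right ?_
    obtain ⟨G, hG, hE⟩ := exists_abs_empMean_sub_le hp hp1 hm hc hα hα1 𝒜 h𝒜 hne hd
    refine le_trans ?_ hE
    refine Finset.sum_le_sum fun s _ => ?_
    simp only [mul_assoc, ← Finset.mul_sum]
    refine mul_le_mul_of_nonneg_left (Finset.sup'_le hne _ fun a ha => ?_) (hp s).le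
    have hrep : empMean s a - μ a = ∑ t, p t * (empMean s a - empMean t a) := by
      simp only [mul_sub, Finset.sum_sub_distrib, ← Finset.sum_mul, hp1, one_mul, hμ]
    rw [hrep]
    refine (Finset.abs_sum_le_sum_abs _ _).trans (Finset.sum_le_sum fun t _ => ?_)
    rw [abs_mul, abs_of_pos (hp t)]
    exact mul_le_mul_of_nonneg_left (hG a ha s t) (hp t).le

lemma sum_mul_empMean_of_marginal (hm : 0 < m) {D : X → ℝ}
    (hD : ∀ (i : Fin m) (x : X), (∑ z, if z i = x then p z else 0) = D x) (a : Set X) :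
    ∑ s, p s * empMean s a = ∑ x, if x ∈ a then D x else 0 := by
  have hm' : (m : ℝ) ≠ 0 := by exact_mod_cast hm.ne'
  have hi : ∀ i : Fin m, (∑ s, p s * if s i ∈ a then (1 : ℝ) else 0) =
      ∑ x, if x ∈ a then D x else 0 := by
    intro i
    calc (∑ s, p s * if s i ∈ a then (1 : ℝ) else 0)
        = ∑ s, ∑ x, if x ∈ a then (if s i = x then p s else 0) else 0 := by
          refine Finset.sum_congr rfl fun s _ => ?_
          rw [Finset.sum_eq_single (s i)]
          · simp
          · intro x _ hx
            simp [hx.symm]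
          · simp
      _ = _ := by
          rw [Finset.sum_comm]
          refine Finset.sum_congr rfl fun x _ => ?_
          split_ifs
          · exact hD i x
          · simp
  simp only [empMean, mul_left_comm _ (m : ℝ)⁻¹, Finset.mul_sum]
  rw [Finset.sum_comm]
  simp only [← Finset.mul_sum, hi]
  rw [Finset.sum_const, Finset.card_univ, Fintype.card_fin, nsmul_eq_mul,
    inv_mul_cancel_left₀ hm']

/-- Chernoff's bound for a function whose mean is at most half the threshold. -/
lemma one_sub_exp_le_sum_ite (hp : ∀ z, 0 < p z) (hp1 : ∑ z, p z = 1)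
    {f : (Fin m → X) → ℝ} {n ε : ℝ} (hn : 0 < n) (hε : 0 < ε)
    (hmgf : ∀ θ, ∑ x, p x * Real.exp (θ * (f x - ∑ y, p y * f y)) ≤
      Real.exp (1 / (4 * n) * θ ^ 2))
    (hmean : ∑ y, p y * f y ≤ ε / 2) :
    1 - Real.exp (-(n * ε ^ 2) / 4) ≤ ∑ s, if f s ≤ ε then p s else 0 := by
  have hbad : ∀ s, p s - (if f s ≤ ε then p s else 0) ≤
      p s * Real.exp (n * ε * (f s - ∑ y, p y * f y)) * Real.exp (-(n * ε) * (ε / 2)) := by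
    intro s
    rw [mul_assoc, ← Real.exp_add]
    split_ifs with h
    · rw [sub_self]
      exact (mul_pos (hp s) (Real.exp_pos _)).le
    · rw [sub_zero]
      refine le_mul_of_one_le_right (hp s).le (Real.one_le_exp ?_)
      rw [show n * ε * (f s - ∑ y, p y * f y) + -(n * ε) * (ε / 2) =
        n * ε * (f s - ∑ y, p y * f y - ε / 2) by ring]
      refine mul_nonneg (mul_pos hn hε).le ?_
      linarith [not_le.1 h]
  have h := Finset.sum_le_sum fun s (_ : s ∈ Finset.univ) => hbad s
  rw [Finset.sum_sub_distrib, hp1, ← Finset.sum_mul] at h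
  have h2 := mul_le_mul_of_nonneg_right (hmgf (n * ε)) (Real.exp_pos (-(n * ε) * (ε / 2))).le
  rw [← Real.exp_add, show 1 / (4 * n) * (n * ε) ^ 2 + -(n * ε) * (ε / 2) =
    -(n * ε ^ 2) / 4 by field_simp; ring] at h2
  linarith

end UniformConvergence

/-- There are universal constants `C₁, C₂ > 0` such that the following uniform convergence
result holds for weakly dependent samples.  Let `D` be a distribution on a finite set `X`, let
`A` be a family of subsets of `X` of VC dimension `d`, and let the sample `S = (x₁,…,x_m)` be
drawn from a random vector on `X^m` with strictly positive pmf `p`, all of whose coordinate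
marginals are `D`, and whose log-coefficient `α < 1/2`.  If
`m ≥ max(C₁ log(2/δ)/((1−α)ε²), C₂ d/((1−2α)ε²))`, then with probability at least `1 − δ`,
every `a ∈ A` satisfies `|(1/m) ∑ᵢ 1[xᵢ ∈ a] − D(a)| ≤ ε`. -/
theorem vc_uniform_convergence_dependent :
    ∃ C₁ C₂ : ℝ, 0 < C₁ ∧ 0 < C₂ ∧
      ∀ (X : Type) [Fintype X] [Nonempty X] (D : X → ℝ),
        (∀ x, 0 ≤ D x) → (∑ x, D x = 1) →
        ∀ (A : Set (Set X)) (d : ℕ), vcDim A = d →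
        ∀ (m : ℕ) (p : (Fin m → X) → ℝ), (∀ z, 0 < p z) → (∑ z, p z = 1) →
          (∀ (i : Fin m) (x : X), (∑ z, if z i = x then p z else 0) = D x) →
          logCoefficient p < 1 / 2 →
          ∀ ε δ : ℝ, 0 < ε → ε < 1 → 0 < δ → δ < 1 →
            (m : ℝ) ≥ max (C₁ * Real.log (2 / δ) / ((1 - logCoefficient p) * ε ^ 2))
                (C₂ * d / ((1 - 2 * logCoefficient p) * ε ^ 2)) →
            (∑ s, if ∀ a ∈ A,
                  |(m : ℝ)⁻¹ * (∑ i, if s i ∈ a then (1 : ℝ) else 0) -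
                    ∑ x, if x ∈ a then D x else 0| ≤ ε
                then p s else 0) ≥ 1 - δ := by
  refine ⟨8, 8000, by norm_num, by norm_num, ?_⟩
  intro X _ _ D _ hD1 A d hd m p hp hp1 hD hα ε δ hε hε1 hδ hδ1 hm
  set α := logCoefficient p
  have h1α : 0 < 1 - α := by linarith
  have h2α : 0 < 1 - 2 * α := by linarith
  have hlog : Real.log 2 ≤ Real.log (2 / δ) :=
    Real.log_le_log two_pos ((le_div_iff₀ hδ).2 (by linarith))
  have hlog2 := Real.log_two_gt_d9
  obtain ⟨hm1, hm2⟩ := max_le_iff.1 hm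
  rw [div_le_iff₀ (by positivity)] at hm1 hm2
  have hm' : (0 : ℝ) < m := by
    by_contra h0
    have := mul_nonpos_of_nonpos_of_nonneg (not_lt.1 h0)
      (mul_pos h1α (pow_pos hε 2)).le
    linarith
  have hm0 : 0 < m := by exact_mod_cast hm'
  have h𝒜 : ∀ a, a ∈ A.toFinset ↔ a ∈ A := fun a => Set.mem_toFinset
  set 𝒜 := A.toFinset
  rcases 𝒜.eq_empty_or_nonempty with hempty | hne
  · have hA : ∀ a, a ∉ A := fun a ha => by simpa [hempty] using (h𝒜 a).2 ha
    have hgood : ∀ s : Fin m → X, ∀ a ∈ A,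
        |(m : ℝ)⁻¹ * (∑ i, if s i ∈ a then (1 : ℝ) else 0) -
          ∑ x, if x ∈ a then D x else 0| ≤ ε := fun s a ha => absurd ha (hA a)
    rw [Finset.sum_congr rfl fun s _ => if_pos (hgood s), hp1]
    linarith
  · have hinf := influenceBound_influenceMatrix hp
    have hrow : ∀ i, ∑ j, influenceMatrix p i j ≤ α := sum_influenceMatrix_le p
    set μ : Set X → ℝ := fun a => ∑ x, if x ∈ a then D x else 0 with hμ
    set f : (Fin m → X) → ℝ := fun s => 𝒜.sup' hne fun a => |empMean s a - μ a| with hf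
    have hmean : ∑ s, p s * f s ≤ ε / 2 := by
      refine (sum_mul_sup'_le hp hp1 hm0 hinf hrow hα 𝒜 (fun a => (h𝒜 a).1) hne
        (sum_mul_empMean_of_marginal hm0 hD)).trans (max_le ?_ ?_)
      · have h : 2 / ε ≤ √(m * (1 - α)) := by
          refine Real.le_sqrt_of_sq_le ?_
          rw [div_pow, div_le_iff₀ (pow_pos hε 2)]
          linarith
        calc (√(m * (1 - α)))⁻¹ ≤ (2 / ε)⁻¹ := inv_anti₀ (by positivity) h
          _ = ε / 2 := inv_div _ _
      · have h : √(4 / (m * (1 - 2 * α)) * (5 * vcDim A)) ≤ ε / 20 := by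
          refine Real.sqrt_le_iff.2 ⟨by positivity, ?_⟩
          rw [hd, div_mul_eq_mul_div, div_le_iff₀ (by positivity)]
          linarith
        linarith
    have htail := one_sub_exp_le_sum_ite hp hp1 (n := m * (1 - α)) (by positivity) hε
      (fun θ => by
        have h := sum_mul_exp_mul_sub_mean_le hp hp1 hm0 hinf hrow (by linarith)
          (boundedDiff_sup'_abs_empMean_sub 𝒜 hne μ) θ
        refine h.trans_eq ?_
        rw [Finset.sum_const, Finset.card_univ, Fintype.card_fin, nsmul_eq_mul]
        congr 2
        field_simp) hmean
    have hexp : Real.exp (-(m * (1 - α) * ε ^ 2) / 4) ≤ δ := by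
      rw [← Real.le_log_iff_exp_le hδ]
      rw [Real.log_div two_ne_zero hδ.ne'] at hm1 hlog
      linarith
    have hiff : ∀ s, f s ≤ ε ↔ ∀ a ∈ A,
        |(m : ℝ)⁻¹ * (∑ i, if s i ∈ a then (1 : ℝ) else 0) -
          ∑ x, if x ∈ a then D x else 0| ≤ ε := by
      intro s
      simp only [hf, Finset.sup'_le_iff, h𝒜, empMean, hμ]
    simp only [hiff] at htail
    linarith
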